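/- arXiv:2408.06015 — 9 statements merged into one kernel-verified Lean document; each statement's English description precedes it below -/
import Mathlib

section
/- Let n and d be positive integers. Every loopless digraph G on n vertices with minimum outdegree δ⁺(G) ≥ d contains a nonempty subgraph H whose minimum semidegree satisfies δ±(H) ≥ d(d+1)/(2n). -/
/-- The outdegree of vertex `v` in the digraph on `Fin n` with arc set `A`. -/
def outDeg {n : ℕ} (A : Finset (Fin n × Fin n)) (v : Fin n) : ℕ :=
  (A.filter fun e => e.1 = v).card

/-- The indegree of vertex `v` in the digraph on `Fin n` with arc set `A`. -/
def inDeg {n : ℕ} (A : Finset (Fin n × Fin n)) (v : Fin n) : ℕ :=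
  (A.filter fun e => e.2 = v).card

/-- `(S, B)` is a subgraph of the digraph with arc set `A`: the vertex set `S` is a
subset of the vertices, and the arc set `B` is a subset of `A` whose arcs join
vertices of `S`. -/
def IsSubgraph {n : ℕ} (A : Finset (Fin n × Fin n)) (S : Finset (Fin n))
    (B : Finset (Fin n × Fin n)) : Prop :=
  B ⊆ A ∧ ∀ e ∈ B, e.1 ∈ S ∧ e.2 ∈ S

/-- A digraph on `Fin n` is a tournament if it is loopless and every pair of distinct
vertices is joined by exactly one arc. -/
def IsTournament {n : ℕ} (A : Finset (Fin n × Fin n)) : Prop :=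
  (∀ v : Fin n, (v, v) ∉ A) ∧ ∀ u v : Fin n, u ≠ v → ((u, v) ∈ A ↔ (v, u) ∉ A)

open Finset in
/-- If the total deficit of the outdegrees below `d`, increased by `c` per vertex, is smaller
than `d + (d - 1) + ⋯` with `|S|` (truncated) terms, then `S` has a nonempty subset in which all
outdegrees and indegrees exceed `c`. -/
theorem exists_subset_lt_out_in {V : Type*} [DecidableEq V] (R : V → V → Prop) [DecidableRel R]
    (hirr : ∀ v, ¬ R v v) (c : ℕ) (m : ℕ) : ∀ (d : ℕ) (S : Finset V), #S = m →
    ∑ v ∈ S, (d - #{w ∈ S | R v w}) + c * m < ∑ j ∈ range m, (d - j) →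
    ∃ T ⊆ S, T.Nonempty ∧ ∀ v ∈ T, c < #{w ∈ T | R v w} ∧ c < #{w ∈ T | R w v} := by
  induction m with
  | zero => intro d S _ h; simp at h
  | succ m ih =>
    intro d S hS h
    by_cases hgood : ∀ v ∈ S, c < #{w ∈ S | R v w} ∧ c < #{w ∈ S | R w v}
    · exact ⟨S, subset_rfl, card_pos.1 (by omega), hgood⟩
    push Not at hgood
    obtain ⟨v, hv, hbad⟩ := hgood
    have hT : #(S.erase v) = m := by rw [card_erase_of_mem hv, hS]; rfl
    have hout : ∀ u, #{w ∈ S | R u w} = #{w ∈ S.erase v | R u w} + if R u v then 1 else 0 := by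
      intro u
      conv_lhs => rw [← insert_erase hv]
      rw [filter_insert]
      split_ifs
      · rw [card_insert_of_notMem (by simp)]
      · rfl
    have hsum := add_sum_erase S (fun u => d - #{w ∈ S | R u w}) hv
    rw [← hsum, mul_add] at h
    suffices hsmaller : ∃ d', ∑ u ∈ S.erase v, (d' - #{w ∈ S.erase v | R u w}) + c * m
        < ∑ j ∈ range m, (d' - j) by
      obtain ⟨d', hd'⟩ := hsmaller
      obtain ⟨T, hTS, hgoodT⟩ := ih d' _ hT hd'
      exact ⟨T, hTS.trans (erase_subset _ _), hgoodT⟩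
    by_cases hlow : #{w ∈ S | R v w} ≤ c
    · cases d with
      | zero => simp at h
      | succ d =>
        refine ⟨d, ?_⟩
        rw [sum_range_succ'] at h
        simp only [Nat.add_sub_add_right] at h
        have hle : ∑ u ∈ S.erase v, (d - #{w ∈ S.erase v | R u w})
            ≤ ∑ u ∈ S.erase v, (d + 1 - #{w ∈ S | R u w}) := by
          refine sum_le_sum fun u _ => ?_
          have := hout u
          split_ifs at this <;> omega
        omega
    · refine ⟨d, ?_⟩
      have hin : #{w ∈ S | R w v} ≤ c := hbad (by omega)
      rw [sum_range_succ] at h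
      have hle : ∑ u ∈ S.erase v, (d - #{w ∈ S.erase v | R u w})
          ≤ ∑ u ∈ S.erase v, (d - #{w ∈ S | R u w}) + c := by
        calc _ ≤ ∑ u ∈ S.erase v, ((d - #{w ∈ S | R u w}) + if R u v then 1 else 0) := by
              refine sum_le_sum fun u _ => ?_
              have := hout u
              omega
          _ = ∑ u ∈ S.erase v, (d - #{w ∈ S | R u w}) + #{u ∈ S.erase v | R u v} := by
              rw [sum_add_distrib, card_filter]
          _ ≤ _ := by
              gcongr
              exact (card_le_card (filter_subset_filter _ (erase_subset _ _))).trans hin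
      have hdeg : #{w ∈ S | R v w} ≤ m := by
        rw [hout v, if_neg (hirr v), add_zero, ← hT]
        exact card_filter_le _ _
      omega

theorem two_mul_sum_range_sub {n d : ℕ} (h : d ≤ n) :
    2 * ∑ j ∈ Finset.range n, (d - j) = d * (d + 1) := by
  induction d generalizing n with
  | zero => simp
  | succ d ih =>
    obtain ⟨n, rfl⟩ : ∃ k, n = k + 1 := ⟨n - 1, by omega⟩
    rw [Finset.sum_range_succ']
    simp only [Nat.add_sub_add_right]
    rw [mul_add, ih (by omega)]
    simp only [Nat.sub_zero]
    ring

open Finset in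
theorem outDeg_filter_mem {n : ℕ} (A : Finset (Fin n × Fin n)) {S : Finset (Fin n)} {v : Fin n}
    (hv : v ∈ S) :
    outDeg {e ∈ A | e.1 ∈ S ∧ e.2 ∈ S} v = #{w ∈ S | (v, w) ∈ A} := by
  symm
  refine card_bij (fun w _ => (v, w)) ?_ ?_ ?_
  · simp +contextual [hv]
  · simp
  · rintro ⟨a, b⟩ h
    simp only [mem_filter] at h
    obtain ⟨⟨hA, _, hb⟩, rfl⟩ := h
    exact ⟨b, by simp [hA, hb], rfl⟩

open Finset in
theorem inDeg_filter_mem {n : ℕ} (A : Finset (Fin n × Fin n)) {S : Finset (Fin n)} {v : Fin n}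
    (hv : v ∈ S) :
    inDeg {e ∈ A | e.1 ∈ S ∧ e.2 ∈ S} v = #{w ∈ S | (w, v) ∈ A} := by
  symm
  refine card_bij (fun w _ => (w, v)) ?_ ?_ ?_
  · simp +contextual [hv]
  · simp
  · rintro ⟨a, b⟩ h
    simp only [mem_filter] at h
    obtain ⟨⟨hA, ha, _⟩, rfl⟩ := h
    exact ⟨a, by simp [hA, ha], rfl⟩

/-- Every loopless digraph on `n` vertices with minimum outdegree at least `d` contains a
nonempty subgraph whose minimum semidegree is at least `d(d+1)/(2n)`. -/
theorem min_semidegree_subgraph (n d : ℕ) (hn : 0 < n) (hd : 0 < d)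
    (A : Finset (Fin n × Fin n)) (hloopless : ∀ v : Fin n, (v, v) ∉ A)
    (hmindeg : ∀ v : Fin n, d ≤ outDeg A v) :
    ∃ (S : Finset (Fin n)) (B : Finset (Fin n × Fin n)),
      S.Nonempty ∧ IsSubgraph A S B ∧
      ∀ v ∈ S, ((d : ℝ) * (d + 1)) / (2 * n) ≤ (min (outDeg B v) (inDeg B v) : ℝ) := by
  have hdeg : ∀ v, d ≤ (Finset.univ.filter fun w => (v, w) ∈ A).card := fun v => by
    rw [← outDeg_filter_mem A (Finset.mem_univ v)]
    simpa using hmindeg v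
  have hdn : d ≤ n := by
    simpa using (hdeg ⟨0, hn⟩).trans (Finset.card_filter_le _ _)
  have hnR : (0 : ℝ) < 2 * n := by positivity
  obtain ⟨c, hc⟩ : ∃ c, ⌈((d : ℝ) * (d + 1)) / (2 * n)⌉₊ = c + 1 :=
    Nat.exists_eq_add_one.2 (Nat.ceil_pos.2 (by positivity))
  have hlt : 2 * (c * n) < d * (d + 1) := by
    have h : (c : ℝ) < ((d : ℝ) * (d + 1)) / (2 * n) := Nat.lt_ceil.1 (by omega)
    rw [lt_div_iff₀ hnR] at h
    have h' : (2 * (c * n) : ℝ) < d * (d + 1) := by linarith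
    exact_mod_cast h'
  have hle : ((d : ℝ) * (d + 1)) / (2 * n) ≤ (c + 1 : ℕ) := hc ▸ Nat.le_ceil _
  obtain ⟨S, -, hS, hgood⟩ := exists_subset_lt_out_in (fun v w => (v, w) ∈ A) hloopless c n d
    Finset.univ (by simp) (by
      rw [Finset.sum_eq_zero fun v _ => Nat.sub_eq_zero_of_le (hdeg v)]
      have := two_mul_sum_range_sub hdn
      omega)
  refine ⟨S, A.filter fun e => e.1 ∈ S ∧ e.2 ∈ S, hS,
    ⟨Finset.filter_subset _ _, fun e he => (Finset.mem_filter.1 he).2⟩, fun v hv => ?_⟩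
  rw [outDeg_filter_mem A hv, inDeg_filter_mem A hv]
  exact le_min (hle.trans (Nat.cast_le.2 (hgood v hv).1)) (hle.trans (Nat.cast_le.2 (hgood v hv).2))
end

section
/- Fix positive integers k and ℓ, and set d := 2kℓ − 1 and n₀ := (k+1)d + ℓ. For every integer n ≥ n₀ there exists a tournament T on n vertices with minimum outdegree δ⁺(T) = d such that every nonempty subgraph H of T satisfies δ±(H) ≤ ℓ. -/
/-- The arcs from `x` to the `y`-th vertex above the initial segment: vertices `x` and `d - x`
together dominate each vertex of one block of length `d`, exactly once. -/
def BlockArc (d ℓ x y : ℕ) : Prop :=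
  min x (d - x) / ℓ = y / d ∧ ((2 * x < d ∧ y % d < d - x) ∨ (d ≤ 2 * x ∧ x ≤ y % d))

/-- The exceptional arcs, directed from a smaller to a larger vertex; all of them leave the
initial segment of length `d + ℓ`. -/
def UpArc (d ℓ u v : ℕ) : Prop :=
  u < d + ℓ ∧ d + ℓ ≤ v ∧ BlockArc d ℓ u (v - (d + ℓ))

/-- Larger vertices dominate smaller ones, except along the arcs of `UpArc`. -/
def TourArc (d ℓ u v : ℕ) : Prop :=
  (v < u ∧ ¬ UpArc d ℓ v u) ∨ (u < v ∧ UpArc d ℓ u v)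

theorem not_upArc_of_lt {d ℓ u v : ℕ} (hv : v < d + ℓ) : ¬ UpArc d ℓ u v :=
  fun h => absurd h.2.1 (by omega)

theorem BlockArc.lt {d ℓ x y : ℕ} (hd : 0 < d) (h : BlockArc d ℓ x y) : x < d := by
  have := Nat.mod_lt y hd
  obtain ⟨-, h | h⟩ := h <;> omega

open Classical in
theorem card_blockArc_le {d ℓ : ℕ} (hd : 0 < d) (hℓ : 0 < ℓ) (m y : ℕ) :
    ((Finset.range m).filter fun x => BlockArc d ℓ x y).card ≤ ℓ := by
  have hcard : (Finset.Ico (ℓ * (y / d)) (ℓ * (y / d) + ℓ)).card = ℓ := by simp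
  refine (Finset.card_le_card_of_injOn (fun x => min x (d - x)) ?_ ?_).trans hcard.le
  · intro x hx
    have hx := (Finset.mem_filter.1 (Finset.mem_coe.1 hx)).2
    have h1 := Nat.div_add_mod (min x (d - x)) ℓ
    have h2 := Nat.mod_lt (min x (d - x)) hℓ
    rw [hx.1] at h1
    simp only [Finset.coe_Ico, Set.mem_Ico]
    omega
  · intro x hx x' hx' hxx'
    have hx := (Finset.mem_filter.1 (Finset.mem_coe.1 hx)).2
    have hx' := (Finset.mem_filter.1 (Finset.mem_coe.1 hx')).2
    have := hx.lt hd
    have := hx'.lt hd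
    obtain ⟨-, h⟩ := hx
    obtain ⟨-, h'⟩ := hx'
    simp only at hxx'
    omega

open Classical in
theorem card_upArc_le {d ℓ : ℕ} (hd : 0 < d) (hℓ : 0 < ℓ) (v : ℕ) :
    ((Finset.range (d + ℓ)).filter fun u => UpArc d ℓ u v).card ≤ ℓ :=
  (Finset.card_le_card (Finset.monotone_filter_right _ fun _ _ h => h.2.2)).trans
    (card_blockArc_le hd hℓ (d + ℓ) (v - (d + ℓ)))

/-- Below `d`, every vertex has at least `d - x` outgoing exceptional arcs. -/
theorem exists_blockArc_finset {k d ℓ x : ℕ} (hd : d + 1 = 2 * (k * ℓ)) (hx : x < d) :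
    ∃ t : Finset ℕ, t.card = d - x ∧ ∀ y ∈ t, y < k * d ∧ BlockArc d ℓ x y := by
  have hq : min x (d - x) / ℓ < k := by
    refine Nat.div_lt_of_lt_mul ?_
    rw [mul_comm]
    omega
  have key : ∀ o < d, ((2 * x < d ∧ o < d - x) ∨ (d ≤ 2 * x ∧ x ≤ o)) →
      d * (min x (d - x) / ℓ) + o < k * d ∧ BlockArc d ℓ x (d * (min x (d - x) / ℓ) + o) := by
    intro o ho h
    refine ⟨?_, ?_, ?_⟩
    · nlinarith
    · rw [Nat.mul_add_div (by omega), Nat.div_eq_of_lt ho, add_zero]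
    · rwa [Nat.mul_add_mod, Nat.mod_eq_of_lt ho]
  have hinj : Function.Injective fun o => d * (min x (d - x) / ℓ) + o := add_right_injective _
  by_cases h : 2 * x < d
  · refine ⟨(Finset.range (d - x)).image fun o => d * (min x (d - x) / ℓ) + o, ?_, ?_⟩
    · rw [Finset.card_image_of_injective _ hinj, Finset.card_range]
    · simp only [Finset.forall_mem_image, Finset.mem_range]
      exact fun o ho => key o (by omega) (Or.inl ⟨h, ho⟩)
  · refine ⟨(Finset.Ico x d).image fun o => d * (min x (d - x) / ℓ) + o, ?_, ?_⟩
    · rw [Finset.card_image_of_injective _ hinj, Nat.card_Ico]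
    · simp only [Finset.forall_mem_image, Finset.mem_Ico]
      exact fun o ho => key o ho.2 (Or.inr ⟨by omega, ho.1⟩)

theorem card_le_outDeg {n : ℕ} {A : Finset (Fin n × Fin n)} {v : Fin n} (t : Finset ℕ)
    (ht : ∀ w ∈ t, ∃ h : w < n, (v, (⟨w, h⟩ : Fin n)) ∈ A) : t.card ≤ outDeg A v := by
  refine Finset.card_le_card_of_surjOn (fun e => (e.2 : ℕ)) fun w hw => ?_
  obtain ⟨h, hA⟩ := ht w hw
  exact ⟨(v, ⟨w, h⟩), by simpa using hA, rfl⟩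

theorem outDeg_le_card {n : ℕ} {A : Finset (Fin n × Fin n)} {v : Fin n} (t : Finset ℕ)
    (ht : ∀ w, (v, w) ∈ A → (w : ℕ) ∈ t) : outDeg A v ≤ t.card := by
  refine Finset.card_le_card_of_injOn (fun e => (e.2 : ℕ)) ?_ ?_
  · rintro ⟨u, w⟩ he
    obtain ⟨hA, rfl⟩ := Finset.mem_filter.1 (Finset.mem_coe.1 he)
    exact ht w hA
  · rintro ⟨u, w⟩ he ⟨u', w'⟩ he' h
    have h₁ : u = v := (Finset.mem_filter.1 (Finset.mem_coe.1 he)).2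
    have h₂ : u' = v := (Finset.mem_filter.1 (Finset.mem_coe.1 he')).2
    exact Prod.ext (h₁.trans h₂.symm) (Fin.ext h)

theorem inDeg_le_card {n : ℕ} {A : Finset (Fin n × Fin n)} {v : Fin n} (t : Finset ℕ)
    (ht : ∀ u, (u, v) ∈ A → (u : ℕ) ∈ t) : inDeg A v ≤ t.card := by
  refine Finset.card_le_card_of_injOn (fun e => (e.1 : ℕ)) ?_ ?_
  · rintro ⟨u, w⟩ he
    obtain ⟨hA, rfl⟩ := Finset.mem_filter.1 (Finset.mem_coe.1 he)
    exact ht u hA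
  · rintro ⟨u, w⟩ he ⟨u', w'⟩ he' h
    have h₁ : w = v := (Finset.mem_filter.1 (Finset.mem_coe.1 he)).2
    have h₂ : w' = v := (Finset.mem_filter.1 (Finset.mem_coe.1 he')).2
    exact Prod.ext (Fin.ext h) (h₁.trans h₂.symm)

open Classical in
/-- The digraph on `Fin n` given by `TourArc`. -/
noncomputable def tourArcs (d ℓ n : ℕ) : Finset (Fin n × Fin n) :=
  Finset.univ.filter fun e => TourArc d ℓ e.1 e.2

theorem mem_tourArcs {d ℓ n : ℕ} {u v : Fin n} :
    (u, v) ∈ tourArcs d ℓ n ↔ TourArc d ℓ u v := by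
  simp [tourArcs]

theorem isTournament_tourArcs (d ℓ n : ℕ) : IsTournament (tourArcs d ℓ n) := by
  refine ⟨fun v h => ?_, fun u v huv => ?_⟩
  · rw [mem_tourArcs] at h
    rcases h with h | h <;> exact lt_irrefl _ h.1
  · rw [mem_tourArcs, mem_tourArcs]
    unfold TourArc
    rcases lt_or_gt_of_ne (Fin.val_ne_of_ne huv) with h | h
    · simp [h, h.not_gt]
    · simp [h, h.not_gt]

theorem le_outDeg_tourArcs {k d ℓ n : ℕ} (hd : d + 1 = 2 * (k * ℓ)) (hd' : 0 < d) (hℓ : 0 < ℓ)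
    (hn : k * d + (d + ℓ) ≤ n) (v : Fin n) : d ≤ outDeg (tourArcs d ℓ n) v := by
  classical
  rcases lt_or_ge (v : ℕ) (d + ℓ) with hv | hv
  · have hlow : ∀ w < (v : ℕ), TourArc d ℓ v w := fun w hw => Or.inl ⟨hw, not_upArc_of_lt hv⟩
    rcases lt_or_ge (v : ℕ) d with hvd | hvd
    · obtain ⟨t, htc, ht⟩ := exists_blockArc_finset hd hvd
      have hdisj : Disjoint (Finset.range v) (t.image fun y => d + ℓ + y) := by
        rw [Finset.disjoint_left]
        intro a ha hat
        obtain ⟨y, -, rfl⟩ := Finset.mem_image.1 hat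
        rw [Finset.mem_range] at ha
        omega
      have hcard : (Finset.range v ∪ t.image fun y => d + ℓ + y).card = d := by
        rw [Finset.card_union_of_disjoint hdisj,
          Finset.card_image_of_injective _ (add_right_injective _), Finset.card_range, htc]
        omega
      refine hcard.ge.trans (card_le_outDeg _ fun w hw => ?_)
      rcases Finset.mem_union.1 hw with hw | hw
      · rw [Finset.mem_range] at hw
        exact ⟨hw.trans v.2, mem_tourArcs.2 (hlow w hw)⟩
      · obtain ⟨y, hy, rfl⟩ := Finset.mem_image.1 hw
        refine ⟨by have := (ht y hy).1; omega, mem_tourArcs.2 (Or.inr ⟨?_, hv, ?_, ?_⟩)⟩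
        · show (v : ℕ) < d + ℓ + y
          omega
        · exact Nat.le_add_right _ _
        · simpa using (ht y hy).2
    · refine hvd.trans ((Finset.card_range v).ge.trans (card_le_outDeg _ fun w hw => ?_))
      rw [Finset.mem_range] at hw
      exact ⟨hw.trans v.2, mem_tourArcs.2 (hlow w hw)⟩
  · have hsplit := Finset.card_filter_add_card_filter_not (s := Finset.range (d + ℓ))
      (fun u => UpArc d ℓ u v)
    have hle := card_upArc_le hd' hℓ v
    rw [Finset.card_range] at hsplit
    refine le_trans (by omega)
      (card_le_outDeg ((Finset.range (d + ℓ)).filter fun u => ¬ UpArc d ℓ u v) fun w hw => ?_)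
    obtain ⟨hw, hwv⟩ := Finset.mem_filter.1 hw
    rw [Finset.mem_range] at hw
    exact ⟨(hw.trans_le hv).trans v.2, mem_tourArcs.2 (Or.inl ⟨hw.trans_le hv, hwv⟩)⟩

theorem outDeg_tourArcs_le {d ℓ n : ℕ} (hd : 0 < d) {v : Fin n} (hv : (v : ℕ) = d) :
    outDeg (tourArcs d ℓ n) v ≤ d := by
  refine (outDeg_le_card (Finset.range d) fun w hw => ?_).trans (Finset.card_range d).le
  rw [Finset.mem_range]
  rcases mem_tourArcs.1 hw with h | h
  · omega
  · exact absurd (h.2.2.2.lt hd) (by omega)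

theorem exists_min_degree_le_of_isSubgraph_tourArcs {d ℓ n : ℕ} (hd : 0 < d) (hℓ : 0 < ℓ)
    {S : Finset (Fin n)} {B : Finset (Fin n × Fin n)} (hS : S.Nonempty)
    (hB : IsSubgraph (tourArcs d ℓ n) S B) :
    ∃ v ∈ S, min (outDeg B v) (inDeg B v) ≤ ℓ := by
  classical
  rcases lt_or_ge (S.max' hS : ℕ) (d + ℓ) with hv | hv
  · refine ⟨S.min' hS, S.min'_mem hS, (min_le_left _ _).trans ?_⟩
    refine (outDeg_le_card ∅ fun w hw => ?_).trans (Nat.zero_le _)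
    have hwS := (hB.2 _ hw).2
    have hmin : (S.min' hS : ℕ) ≤ w := S.min'_le w hwS
    have hmax : (w : ℕ) ≤ S.max' hS := S.le_max' w hwS
    rcases mem_tourArcs.1 (hB.1 hw) with h | h
    · exact absurd h.1 hmin.not_gt
    · exact absurd h.2 (not_upArc_of_lt (hmax.trans_lt hv))
  · refine ⟨S.max' hS, S.max'_mem hS, (min_le_right _ _).trans ?_⟩
    refine (inDeg_le_card ((Finset.range (d + ℓ)).filter fun u => UpArc d ℓ u (S.max' hS))
      fun u hu => ?_).trans (card_upArc_le hd hℓ _)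
    have hmax : (u : ℕ) ≤ S.max' hS := S.le_max' u (hB.2 _ hu).1
    rcases mem_tourArcs.1 (hB.1 hu) with h | h
    · exact absurd h.1 hmax.not_gt
    · exact Finset.mem_filter.2 ⟨Finset.mem_range.2 h.2.1, h.2⟩

/-- For `d = 2kℓ - 1` and `n₀ = (k+1)d + ℓ`, every `n ≥ n₀` admits an `n`-vertex tournament
with minimum outdegree exactly `d` in which every nonempty subgraph has minimum
semidegree at most `ℓ`. -/
theorem tournament_all_subgraphs_small_semidegree (k ℓ : ℕ) (hk : 0 < k) (hℓ : 0 < ℓ)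
    (n : ℕ) (hn : (k + 1) * (2 * k * ℓ - 1) + ℓ ≤ n) :
    ∃ A : Finset (Fin n × Fin n), IsTournament A ∧
      (∀ v : Fin n, 2 * k * ℓ - 1 ≤ outDeg A v) ∧
      (∃ v : Fin n, outDeg A v = 2 * k * ℓ - 1) ∧
      ∀ (S : Finset (Fin n)) (B : Finset (Fin n × Fin n)),
        S.Nonempty → IsSubgraph A S B →
        ∃ v ∈ S, min (outDeg B v) (inDeg B v) ≤ ℓ := by
  have hkℓ : 0 < k * ℓ := Nat.mul_pos hk hℓ
  obtain ⟨d, hd⟩ : ∃ d, 2 * k * ℓ - 1 = d := ⟨_, rfl⟩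
  rw [hd] at hn ⊢
  rw [mul_assoc] at hd
  have hd₁ : d + 1 = 2 * (k * ℓ) := by omega
  have hd₀ : 0 < d := by omega
  have hn' : k * d + (d + ℓ) ≤ n := by linarith
  have hle := le_outDeg_tourArcs hd₁ hd₀ hℓ hn'
  refine ⟨tourArcs d ℓ n, isTournament_tourArcs d ℓ n, hle, ⟨⟨d, by omega⟩, ?_⟩, ?_⟩
  · exact le_antisymm (outDeg_tourArcs_le hd₀ rfl) (hle _)
  · exact fun S B hS hB => exists_min_degree_le_of_isSubgraph_tourArcs hd₀ hℓ hS hB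
end

section
/- For every integer n ≥ 2 there exists a loopless digraph G on n vertices with minimum outdegree δ⁺(G) ≥ ⌊√(2n)⌋ − 2 such that every nonempty subgraph H of G satisfies δ±(H) ≤ 1. -/
/-- The arc relation of the construction. Vertices below `k` point to all smaller vertices, and
vertex `u < k` also points to the vertices `k + i * (i + 1) / 2 + u` with `u ≤ i < k`. Vertices from
`k` on point to all vertices below `k`. -/
def triangularArc (k u v : ℕ) : Prop :=
  (k ≤ u ∧ v < k) ∨ (u < k ∧ v < u) ∨
    (u < k ∧ ∃ i, u ≤ i ∧ i < k ∧ 2 * v = 2 * k + i * (i + 1) + 2 * u)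

theorem triangular_index_le {i j a b : ℕ} (ha : a ≤ i)
    (h : i * (i + 1) + 2 * a = j * (j + 1) + 2 * b) : j ≤ i := by
  by_contra! hij
  nlinarith [Nat.mul_le_mul hij (Nat.succ_le_succ hij)]

theorem triangularArc_ne {k u v : ℕ} (h : triangularArc k u v) : u ≠ v := by
  rcases h with h | h | ⟨h, i, -, -, hi⟩
  · omega
  · omega
  · have := Nat.zero_le (i * (i + 1))
    omega

theorem triangularArc_source_unique {k u u' v : ℕ} (hv : k ≤ v) (h : triangularArc k u v)
    (h' : triangularArc k u' v) : u = u' := by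
  rcases h with h | h | ⟨-, i, hui, -, hi⟩
  · omega
  · omega
  rcases h' with h' | h' | ⟨-, j, huj, -, hj⟩
  · omega
  · omega
  have hij : i = j := le_antisymm (triangular_index_le (b := u) huj (by omega))
    (triangular_index_le (b := u') hui (by omega))
  subst hij
  omega

theorem le_outDeg_of_injOn {n k : ℕ} {A : Finset (Fin n × Fin n)} {u : Fin n} (f : ℕ → ℕ)
    (hf : Set.InjOn f (Finset.range k))
    (h : ∀ i < k, ∃ hi : f i < n, (u, (⟨f i, hi⟩ : Fin n)) ∈ A) : k ≤ outDeg A u := by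
  calc k = ((Finset.range k).image f).card := by
        rw [Finset.card_image_of_injOn hf, Finset.card_range]
    _ ≤ ((A.filter fun e => e.1 = u).image fun e => (e.2 : ℕ)).card := by
        refine Finset.card_le_card fun x hx => ?_
        obtain ⟨i, hi, rfl⟩ := Finset.mem_image.1 hx
        obtain ⟨hlt, hmem⟩ := h i (Finset.mem_range.1 hi)
        exact Finset.mem_image.2 ⟨_, Finset.mem_filter.2 ⟨hmem, rfl⟩, rfl⟩
    _ ≤ outDeg A u := Finset.card_image_le

/-- For every `n ≥ 2` there is a loopless digraph on `n` vertices with minimum outdegree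
at least `⌊√(2n)⌋ - 2` all of whose nonempty subgraphs have minimum semidegree at most `1`. -/
theorem exists_digraph_all_subgraphs_semidegree_le_one (n : ℕ) (hn : 2 ≤ n) :
    ∃ A : Finset (Fin n × Fin n), (∀ v : Fin n, (v, v) ∉ A) ∧
      (∀ v : Fin n, Nat.sqrt (2 * n) - 2 ≤ outDeg A v) ∧
      ∀ (S : Finset (Fin n)) (B : Finset (Fin n × Fin n)),
        S.Nonempty → IsSubgraph A S B →
        ∃ v ∈ S, min (outDeg B v) (inDeg B v) ≤ 1 := by
  classical
  obtain ⟨k, hk⟩ : ∃ k, k = Nat.sqrt (2 * n) - 2 := ⟨_, rfl⟩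
  rw [← hk]
  have hkn : 0 < k → k * k + 4 * k + 4 ≤ 2 * n := fun hpos => by
    have hs : Nat.sqrt (2 * n) = k + 2 := by omega
    have := Nat.sqrt_le (2 * n)
    rw [hs] at this
    linarith
  have mem_arcs (u v : Fin n) :
      (u, v) ∈ Finset.univ.filter (fun e : Fin n × Fin n => triangularArc k e.1 e.2) ↔
        triangularArc k u v := by simp
  refine ⟨Finset.univ.filter fun e => triangularArc k e.1 e.2, fun v hv => ?_, fun u => ?_,
    fun S B hS hB => ?_⟩
  · exact triangularArc_ne ((mem_arcs v v).1 hv) rfl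
  · rcases le_or_gt k u with hu | hu
    · exact le_outDeg_of_injOn id (Set.injOn_id _) fun i hi =>
        ⟨by simp only [id]; omega, (mem_arcs _ _).2 (Or.inl ⟨hu, hi⟩)⟩
    · have half (i : ℕ) : 2 * (i * (i + 1) / 2) = i * (i + 1) :=
        Nat.two_mul_div_two_of_even (Nat.even_mul_succ_self i)
      refine le_outDeg_of_injOn (fun i => if i < u then i else k + i * (i + 1) / 2 + u) ?_ ?_
      · intro i hi j hj hij
        simp only [Finset.coe_range, Set.mem_Iio] at hi hj hij
        have h₁ := half i
        have h₂ := half j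
        split_ifs at hij with hiu hju hju
        · exact hij
        · omega
        · omega
        · exact le_antisymm
            (triangular_index_le (a := u) (b := u) (by omega) (by omega))
            (triangular_index_le (a := u) (b := u) (by omega) (by omega))
      · intro i hi
        have hb := hkn (by omega)
        have h₁ := half i
        by_cases hiu : i < u
        · simp only [hiu, if_true]
          exact ⟨by omega, (mem_arcs _ _).2 (Or.inr (Or.inl ⟨hu, hiu⟩))⟩
        · simp only [hiu, if_false]
          have hm : i * (i + 1) ≤ (k - 1) * k := Nat.mul_le_mul (by omega) (by omega)
          have hm' : (k - 1) * k + k = k * k := by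
            rw [← Nat.succ_mul]
            congr 1
            omega
          refine ⟨by omega, (mem_arcs _ _).2 (Or.inr (Or.inr ⟨hu, i, by omega, hi, ?_⟩))⟩
          simp only
          omega
  · by_cases hlarge : ∃ v ∈ S, k ≤ (v : ℕ)
    · obtain ⟨v, hvS, hv⟩ := hlarge
      refine ⟨v, hvS, min_le_of_right_le (Finset.card_le_one.2 ?_)⟩
      rintro ⟨a, b⟩ he ⟨a', b'⟩ he'
      obtain ⟨heB, rfl : b = v⟩ := Finset.mem_filter.1 he
      obtain ⟨heB', rfl : b' = b⟩ := Finset.mem_filter.1 he'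
      have : a = a' := Fin.ext (triangularArc_source_unique hv
        ((mem_arcs _ _).1 (hB.1 heB)) ((mem_arcs _ _).1 (hB.1 heB')))
      rw [this]
    · push Not at hlarge
      refine ⟨S.min' hS, S.min'_mem hS, min_le_of_left_le ?_⟩
      suffices h : outDeg B (S.min' hS) = 0 by omega
      refine Finset.card_eq_zero.2 (Finset.filter_eq_empty_iff.2 ?_)
      rintro ⟨a, b⟩ he ha
      have haS := hlarge a (hB.2 _ he).1
      have hbS := hlarge b (hB.2 _ he).2
      have hab : a ≤ b := by
        have := S.min'_le b (hB.2 _ he).2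
        rwa [← ha] at this
      have hab' : (a : ℕ) ≤ b := hab
      rcases (mem_arcs _ _).1 (hB.1 he) with h | h | ⟨-, i, -, -, hi⟩
      · omega
      · omega
      · have := Nat.zero_le (i * (i + 1))
        omega
end

section
/- Let d and ℓ be positive integers and let T₀ be a tournament on n₀ vertices with minimum outdegree δ⁺(T₀) = d such that every nonempty subgraph H of T₀ satisfies δ±(H) ≤ ℓ. Then for every integer n ≥ n₀ there exists a tournament T on n vertices with δ⁺(T) = d such that every nonempty subgraph H of T satisfies δ±(H) ≤ ℓ. -/
theorem outDeg_eq_sum {n : ℕ} (A : Finset (Fin n × Fin n)) (v : Fin n) :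
    outDeg A v = ∑ w, if (v, w) ∈ A then 1 else 0 := by
  rw [outDeg, ← Finset.card_filter]
  refine Finset.card_nbij' Prod.snd (fun w => (v, w)) ?_ ?_ ?_ ?_ <;>
    grind [Set.MapsTo, Set.LeftInvOn]

theorem inDeg_eq_sum {n : ℕ} (A : Finset (Fin n × Fin n)) (v : Fin n) :
    inDeg A v = ∑ u, if (u, v) ∈ A then 1 else 0 := by
  rw [inDeg, ← Finset.card_filter]
  refine Finset.card_nbij' Prod.fst (fun u => (u, v)) ?_ ?_ ?_ ?_ <;>
    grind [Set.MapsTo, Set.LeftInvOn]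

/-- The digraph obtained by adding a new last vertex dominating all the others. -/
def addSource {n : ℕ} (A : Finset (Fin n × Fin n)) : Finset (Fin (n + 1) × Fin (n + 1)) :=
  A.image (Prod.map Fin.castSucc Fin.castSucc) ∪
    Finset.univ.image fun w : Fin n => (Fin.last n, w.castSucc)

/-- The arcs of a digraph that avoid the last vertex. -/
def deleteLast {n : ℕ} (B : Finset (Fin (n + 1) × Fin (n + 1))) : Finset (Fin n × Fin n) :=
  Finset.univ.filter fun e => (e.1.castSucc, e.2.castSucc) ∈ B

section

variable {n : ℕ} {A : Finset (Fin n × Fin n)}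

theorem castSucc_castSucc_mem_addSource {u v : Fin n} :
    (u.castSucc, v.castSucc) ∈ addSource A ↔ (u, v) ∈ A := by
  simp [addSource, (Fin.castSucc_ne_last _).symm]

theorem last_castSucc_mem_addSource {v : Fin n} : (Fin.last n, v.castSucc) ∈ addSource A := by
  simp [addSource]

theorem last_notMem_addSource {u : Fin (n + 1)} : (u, Fin.last n) ∉ addSource A := by
  simp [addSource]

theorem IsTournament.addSource (hA : IsTournament A) : IsTournament (addSource A) := by
  constructor
  · intro v
    cases v using Fin.lastCases with
    | last => exact last_notMem_addSource
    | cast v => simpa [castSucc_castSucc_mem_addSource] using hA.1 v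
  · intro u v huv
    cases u using Fin.lastCases <;> cases v using Fin.lastCases
    · exact absurd rfl huv
    · simp [last_castSucc_mem_addSource, last_notMem_addSource]
    · simp [last_castSucc_mem_addSource, last_notMem_addSource]
    · simpa [castSucc_castSucc_mem_addSource] using hA.2 _ _ (by simpa using huv)

theorem outDeg_addSource_castSucc (v : Fin n) :
    outDeg (addSource A) v.castSucc = outDeg A v := by
  simp [outDeg_eq_sum, Fin.sum_univ_castSucc, castSucc_castSucc_mem_addSource,
    last_notMem_addSource, -Finset.sum_boole]

theorem outDeg_addSource_last : outDeg (addSource A) (Fin.last n) = n := by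
  simp [outDeg_eq_sum, Fin.sum_univ_castSucc, last_castSucc_mem_addSource,
    last_notMem_addSource, -Finset.sum_boole]

theorem outDeg_le (v : Fin n) : outDeg A v ≤ n := by
  rw [outDeg_eq_sum, ← Finset.card_filter]
  exact (Finset.card_le_univ _).trans_eq (Fintype.card_fin n)

theorem exists_min_degree_le_addSource {ℓ : ℕ}
    (hA : ∀ (S : Finset (Fin n)) (B : Finset (Fin n × Fin n)),
      S.Nonempty → IsSubgraph A S B → ∃ v ∈ S, min (outDeg B v) (inDeg B v) ≤ ℓ)
    {S : Finset (Fin (n + 1))} {B : Finset (Fin (n + 1) × Fin (n + 1))}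
    (hS : S.Nonempty) (hB : IsSubgraph (addSource A) S B) :
    ∃ v ∈ S, min (outDeg B v) (inDeg B v) ≤ ℓ := by
  have hin (u : Fin (n + 1)) : (u, Fin.last n) ∉ B := fun h => last_notMem_addSource (hB.1 h)
  by_cases hl : Fin.last n ∈ S
  · exact ⟨_, hl, by simp [inDeg_eq_sum, hin]⟩
  have hout (v : Fin (n + 1)) : (Fin.last n, v) ∉ B := fun h => hl (hB.2 _ h).1
  obtain ⟨v, hv, hle⟩ := hA (Finset.univ.filter fun v => v.castSucc ∈ S) (deleteLast B)
    (by
      obtain ⟨x, hx⟩ := hS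
      cases x using Fin.lastCases with
      | last => exact absurd hx hl
      | cast x => exact ⟨x, by simpa using hx⟩)
    ⟨fun e he => castSucc_castSucc_mem_addSource.1 (hB.1 (by simpa [deleteLast] using he)),
      fun e he => by simpa using hB.2 _ (Finset.mem_filter.1 he).2⟩
  refine ⟨v.castSucc, by simpa using hv, ?_⟩
  simpa [outDeg_eq_sum, inDeg_eq_sum, Fin.sum_univ_castSucc, hin, hout, deleteLast,
    -Finset.sum_boole] using hle

end

/-- If a tournament on `n₀` vertices has minimum outdegree exactly `d` and all its
nonempty subgraphs have minimum semidegree at most `ℓ`, then such a tournament also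
exists on `n` vertices for every `n ≥ n₀`. -/
theorem tournament_extension (d ℓ n₀ : ℕ) (hd : 0 < d) (hℓ : 0 < ℓ)
    (A₀ : Finset (Fin n₀ × Fin n₀)) (hT₀ : IsTournament A₀)
    (hdeg₀ : ∀ v : Fin n₀, d ≤ outDeg A₀ v) (hdeg₀' : ∃ v : Fin n₀, outDeg A₀ v = d)
    (hsub₀ : ∀ (S : Finset (Fin n₀)) (B : Finset (Fin n₀ × Fin n₀)),
      S.Nonempty → IsSubgraph A₀ S B → ∃ v ∈ S, min (outDeg B v) (inDeg B v) ≤ ℓ)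
    (n : ℕ) (hn : n₀ ≤ n) :
    ∃ A : Finset (Fin n × Fin n), IsTournament A ∧
      (∀ v : Fin n, d ≤ outDeg A v) ∧ (∃ v : Fin n, outDeg A v = d) ∧
      ∀ (S : Finset (Fin n)) (B : Finset (Fin n × Fin n)),
        S.Nonempty → IsSubgraph A S B →
        ∃ v ∈ S, min (outDeg B v) (inDeg B v) ≤ ℓ := by
  induction n, hn using Nat.le_induction with
  | base => exact ⟨A₀, hT₀, hdeg₀, hdeg₀', hsub₀⟩
  | succ n _ ih =>
    obtain ⟨A, hT, hdeg, ⟨v, hv⟩, hsub⟩ := ih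
    refine ⟨addSource A, hT.addSource, fun u => ?_,
      ⟨v.castSucc, (outDeg_addSource_castSucc v).trans hv⟩,
      fun S B hS hB => exists_min_degree_le_addSource hsub hS hB⟩
    cases u using Fin.lastCases with
    | last => exact (hdeg v).trans ((outDeg_le v).trans_eq outDeg_addSource_last.symm)
    | cast u => exact (hdeg u).trans_eq (outDeg_addSource_castSucc u).symm
end

section
/- Let α ∈ (0, 1] be a real number and let n be a positive integer. Every loopless digraph G on n vertices with minimum outdegree δ⁺(G) ≥ αn contains a nonempty subgraph H with δ±(H) ≥ (1 − √(3 − 4α + α²)) · n. -/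
/-- The arcs of `A` with both endpoints in `S`. -/
def inducedArcs {n : ℕ} (A : Finset (Fin n × Fin n)) (S : Finset (Fin n)) :
    Finset (Fin n × Fin n) :=
  A.filter fun e => e.1 ∈ S ∧ e.2 ∈ S

theorem isSubgraph_inducedArcs {n : ℕ} (A : Finset (Fin n × Fin n)) (S : Finset (Fin n)) :
    IsSubgraph A S (inducedArcs A S) :=
  ⟨Finset.filter_subset _ _, fun _ he => (Finset.mem_filter.1 he).2⟩

theorem card_eq_sum_outDeg {n : ℕ} (A : Finset (Fin n × Fin n)) :
    A.card = ∑ v, outDeg A v :=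
  Finset.card_eq_sum_card_fiberwise fun _ _ => Finset.mem_univ _

theorem card_inducedArcs_le {n : ℕ} {A : Finset (Fin n × Fin n)}
    (hA : ∀ v : Fin n, (v, v) ∉ A) (S : Finset (Fin n)) :
    (inducedArcs A S).card ≤ S.card * S.card - S.card := by
  rw [← Finset.offDiag_card]
  refine Finset.card_le_card fun e he => ?_
  obtain ⟨heA, h₁, h₂⟩ := Finset.mem_filter.1 he
  refine Finset.mem_offDiag.2 ⟨h₁, h₂, fun h => hA e.1 ?_⟩
  rwa [show (e.1, e.1) = e from Prod.ext rfl h]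

theorem outDeg_inducedArcs_le {n : ℕ} {A : Finset (Fin n × Fin n)}
    (hA : ∀ v : Fin n, (v, v) ∉ A) (S : Finset (Fin n)) (v : Fin n) :
    outDeg (inducedArcs A S) v ≤ (S.erase v).card := by
  refine Finset.card_le_card_of_injOn Prod.snd ?_ ?_
  · rintro ⟨a, b⟩ h
    simp only [inducedArcs, Finset.coe_filter, Finset.mem_filter, Set.mem_ofPred_eq] at h
    obtain ⟨⟨hab, -, hb⟩, rfl⟩ := h
    exact Finset.mem_coe.2 (Finset.mem_erase.2 ⟨fun h => hA a (h ▸ hab), hb⟩)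
  · rintro ⟨a, b⟩ h ⟨c, d⟩ h' hbd
    simp_all

theorem inDeg_inducedArcs_le {n : ℕ} {A : Finset (Fin n × Fin n)}
    (hA : ∀ v : Fin n, (v, v) ∉ A) (S : Finset (Fin n)) (v : Fin n) :
    inDeg (inducedArcs A S) v ≤ (S.erase v).card := by
  refine Finset.card_le_card_of_injOn Prod.fst ?_ ?_
  · rintro ⟨a, b⟩ h
    simp only [inducedArcs, Finset.coe_filter, Finset.mem_filter, Set.mem_ofPred_eq] at h
    obtain ⟨⟨hab, ha, -⟩, rfl⟩ := h
    exact Finset.mem_coe.2 (Finset.mem_erase.2 ⟨fun h => hA b (h ▸ hab), ha⟩)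
  · rintro ⟨a, b⟩ h ⟨c, d⟩ h' hac
    simp_all

theorem card_inducedArcs_le_erase_add {n : ℕ} (A : Finset (Fin n × Fin n))
    (S : Finset (Fin n)) (v : Fin n) :
    (inducedArcs A S).card ≤ (inducedArcs A (S.erase v)).card +
      outDeg (inducedArcs A S) v + inDeg (inducedArcs A S) v := by
  refine (Finset.card_le_card fun e he => ?_).trans
    ((Finset.card_union_le (_ ∪ _) _).trans (Nat.add_le_add_right (Finset.card_union_le _ _) _))
  simp only [inducedArcs, Finset.mem_union, Finset.mem_filter, Finset.mem_erase] at he ⊢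
  tauto

/-- If every nonempty induced subgraph of a loopless digraph has minimum semidegree less than `D`,
then deleting low-degree vertices one at a time bounds the number of arcs. -/
theorem card_inducedArcs_le_of_forall_exists_lt {n : ℕ} {A : Finset (Fin n × Fin n)}
    (hA : ∀ v : Fin n, (v, v) ∉ A) {D : ℝ}
    (hD : ∀ S : Finset (Fin n), S.Nonempty → ∃ v ∈ S,
      min (outDeg (inducedArcs A S) v : ℝ) (inDeg (inducedArcs A S) v) < D)
    (S : Finset (Fin n)) (hS : S.Nonempty) (hDS : D ≤ S.card) :
    ((inducedArcs A S).card : ℝ) ≤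
      (S.card : ℝ) ^ 2 / 2 - S.card / 2 + D * S.card - D ^ 2 / 2 := by
  induction S using Finset.strongInduction with
  | H S ih =>
    have hpos : (1 : ℝ) ≤ S.card := by exact_mod_cast hS.card_pos
    rcases le_or_gt (S.card : ℝ) (D + 1) with hle | hlt
    · have hcard : ((inducedArcs A S).card : ℝ) ≤ S.card * S.card - S.card := by
        have h := card_inducedArcs_le hA S
        rw [← Nat.cast_mul, ← Nat.cast_sub (Nat.le_mul_self _)]
        exact_mod_cast h
      nlinarith
    · obtain ⟨v, hv, hlow⟩ := hD S hS
      have hDpos : 0 < D := lt_of_le_of_lt (by positivity) hlow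
      have herase : ((S.erase v).card : ℝ) = S.card - 1 := by
        rw [Finset.card_erase_of_mem hv, Nat.cast_sub hS.card_pos, Nat.cast_one]
      have hne : (S.erase v).Nonempty := by
        rw [← Finset.card_pos, ← Nat.cast_pos (α := ℝ), herase]
        linarith
      have hrec := ih _ (Finset.erase_ssubset hv) hne (by rw [herase]; linarith)
      have hdel : ((inducedArcs A S).card : ℝ) ≤ (inducedArcs A (S.erase v)).card +
          outDeg (inducedArcs A S) v + inDeg (inducedArcs A S) v := by
        exact_mod_cast card_inducedArcs_le_erase_add A S v
      have hout : (outDeg (inducedArcs A S) v : ℝ) ≤ (S.erase v).card := by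
        exact_mod_cast outDeg_inducedArcs_le hA S v
      have hin : (inDeg (inducedArcs A S) v : ℝ) ≤ (S.erase v).card := by
        exact_mod_cast inDeg_inducedArcs_le hA S v
      rw [herase] at hrec hout hin
      rcases min_lt_iff.1 hlow with h | h <;> nlinarith

/-- Every loopless digraph on `n` vertices with minimum outdegree at least `αn` contains
a nonempty subgraph with minimum semidegree at least `(1 - √(3 - 4α + α²))·n`. -/
theorem dense_digraph_subgraph (α : ℝ) (hα0 : 0 < α) (hα1 : α ≤ 1) (n : ℕ) (hn : 0 < n)
    (A : Finset (Fin n × Fin n)) (hloopless : ∀ v : Fin n, (v, v) ∉ A)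
    (hmindeg : ∀ v : Fin n, α * n ≤ (outDeg A v : ℝ)) :
    ∃ (S : Finset (Fin n)) (B : Finset (Fin n × Fin n)),
      S.Nonempty ∧ IsSubgraph A S B ∧
      ∀ v ∈ S, (1 - Real.sqrt (3 - 4 * α + α ^ 2)) * n ≤
        (min (outDeg B v) (inDeg B v) : ℝ) := by
  by_contra! hcon
  set s := Real.sqrt (3 - 4 * α + α ^ 2)
  have hs0 : 0 ≤ s := Real.sqrt_nonneg _
  have hsq : s ^ 2 = 3 - 4 * α + α ^ 2 := Real.sq_sqrt (by nlinarith)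
  have hn' : (0 : ℝ) < n := by exact_mod_cast hn
  have : Nonempty (Fin n) := ⟨⟨0, hn⟩⟩
  have hupper := card_inducedArcs_le_of_forall_exists_lt hloopless
    (fun S hS => hcon S (inducedArcs A S) hS (isSubgraph_inducedArcs A S))
    Finset.univ Finset.univ_nonempty (by rw [Finset.card_fin]; nlinarith)
  have hlower : α * n * n ≤ (A.card : ℝ) := by
    rw [card_eq_sum_outDeg, Nat.cast_sum]
    calc α * n * n = ∑ _v : Fin n, α * n := by simp [mul_comm]
      _ ≤ _ := Finset.sum_le_sum fun v _ => hmindeg v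
  simp only [inducedArcs, Finset.mem_univ, and_self, Finset.filter_true, Finset.card_fin]
    at hupper
  have hid : (n : ℝ) ^ 2 / 2 - n / 2 + (1 - s) * n * n - ((1 - s) * n) ^ 2 / 2 =
      n ^ 2 * (1 - (3 - 4 * α + α ^ 2) / 2) - n / 2 := by
    rw [← hsq]; ring
  have hα : (n : ℝ) ^ 2 * (1 - (3 - 4 * α + α ^ 2) / 2) ≤ n ^ 2 * α :=
    mul_le_mul_of_nonneg_left (by nlinarith) (by positivity)
  nlinarith
end

section
/- Let α ∈ (0, 1/2] be a real number and let n be a positive integer. Every oriented graph G on n vertices with minimum outdegree δ⁺(G) ≥ αn contains a nonempty subgraph H with δ±(H) ≥ (1 − α − √(3 − 8α + 4α²)) · n. -/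
open Finset in
theorem outDeg_eq_card_filter {n : ℕ} (A : Finset (Fin n × Fin n)) (v : Fin n) :
    outDeg A v = #{w | (v, w) ∈ A} := by
  refine card_bij' (fun e _ => e.2) (fun w _ => (v, w)) ?_ ?_ ?_ ?_
  · rintro ⟨a, b⟩ h
    simp only [mem_filter] at h
    obtain ⟨h, rfl⟩ := h
    simpa using h
  · intro w h
    simpa using h
  · rintro ⟨a, b⟩ h
    simp only [mem_filter] at h
    simp [h.2]
  · simp

open Finset in
theorem inDeg_eq_card_filter {n : ℕ} (A : Finset (Fin n × Fin n)) (v : Fin n) :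
    inDeg A v = #{w | (w, v) ∈ A} := by
  refine card_bij' (fun e _ => e.1) (fun w _ => (w, v)) ?_ ?_ ?_ ?_
  · rintro ⟨a, b⟩ h
    simp only [mem_filter] at h
    obtain ⟨h, rfl⟩ := h
    simpa using h
  · intro w h
    simpa using h
  · rintro ⟨a, b⟩ h
    simp only [mem_filter] at h
    simp [h.2]
  · simp

theorem sum_outDeg_eq_sum_inDeg {n : ℕ} (A : Finset (Fin n × Fin n)) :
    ∑ v, outDeg A v = ∑ v, inDeg A v := by
  have h₁ := Finset.card_eq_sum_card_fiberwise (s := A) (t := Finset.univ)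
    (f := Prod.fst) (fun _ _ => by simp)
  have h₂ := Finset.card_eq_sum_card_fiberwise (s := A) (t := Finset.univ)
    (f := Prod.snd) (fun _ _ => by simp)
  exact h₁.symm.trans h₂

open Finset in
/-- In an oriented graph on `n` vertices every vertex has at most `n - 1` neighbours. -/
theorem outDeg_add_inDeg_add_one_le {n : ℕ} {A : Finset (Fin n × Fin n)}
    (hloopless : ∀ v : Fin n, (v, v) ∉ A)
    (horiented : ∀ u v : Fin n, (u, v) ∈ A → (v, u) ∉ A) (v : Fin n) :
    outDeg A v + inDeg A v + 1 ≤ n := by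
  rw [outDeg_eq_card_filter, inDeg_eq_card_filter, ← card_union_of_disjoint]
  · calc _ ≤ #(univ.erase v) + 1 := by
          gcongr
          intro w hw
          have : w ≠ v := by
            rintro rfl
            simp [hloopless] at hw
          simpa using this
      _ = n := by rw [card_erase_add_one (mem_univ v), card_univ, Fintype.card_fin]
  · rw [disjoint_filter]
    exact fun w _ => horiented v w

/-- The arcs of `A` with both ends outside `R`. -/
def arcsAvoiding {n : ℕ} (A : Finset (Fin n × Fin n)) (R : Finset (Fin n)) :
    Finset (Fin n × Fin n) :=
  A.filter fun e => e.1 ∉ R ∧ e.2 ∉ R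

theorem isSubgraph_arcsAvoiding {n : ℕ} (A : Finset (Fin n × Fin n)) (R : Finset (Fin n)) :
    IsSubgraph A Rᶜ (arcsAvoiding A R) :=
  ⟨Finset.filter_subset _ _, fun e he => by simpa [arcsAvoiding] using (Finset.mem_filter.1 he).2⟩

open Finset in
theorem outDeg_le_outDeg_arcsAvoiding_add {n : ℕ} (A : Finset (Fin n × Fin n))
    {R : Finset (Fin n)} {v : Fin n} (hv : v ∉ R) :
    outDeg A v ≤ outDeg (arcsAvoiding A R) v + #R := by
  rw [outDeg_eq_card_filter, outDeg_eq_card_filter]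
  refine (card_le_card fun w hw => ?_).trans (card_union_le _ _)
  by_cases hR : w ∈ R <;> simp_all [arcsAvoiding]

open Finset in
theorem inDeg_le_inDeg_arcsAvoiding_add {n : ℕ} (A : Finset (Fin n × Fin n))
    {R : Finset (Fin n)} {v : Fin n} (hv : v ∉ R) :
    inDeg A v ≤ inDeg (arcsAvoiding A R) v + #R := by
  rw [inDeg_eq_card_filter, inDeg_eq_card_filter]
  refine (card_le_card fun w hw => ?_).trans (card_union_le _ _)
  by_cases hR : w ∈ R <;> simp_all [arcsAvoiding]

open Finset in
/-- If no nonempty subgraph has minimum semidegree at least `d`, then as long as at most `a - d`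
vertices have been deleted, where `a` bounds the outdegrees from below, a vertex of indegree less
than `d` can be deleted. -/
theorem exists_card_eq_sum_inDeg_le {n : ℕ} {A : Finset (Fin n × Fin n)} {a d : ℝ}
    (hdeg : ∀ v, a ≤ outDeg A v)
    (hno : ∀ (S : Finset (Fin n)) (B : Finset (Fin n × Fin n)), S.Nonempty → IsSubgraph A S B →
      ∃ v ∈ S, (min (outDeg B v) (inDeg B v) : ℝ) < d)
    (j : ℕ) (hjn : j ≤ n) (hj : (j : ℝ) ≤ a - d + 1) :
    ∃ R : Finset (Fin n), #R = j ∧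
      ∑ v ∈ R, (inDeg A v : ℝ) ≤ j * d + j * (j - 1) / 2 := by
  induction j with
  | zero => exact ⟨∅, by simp⟩
  | succ j ih =>
    push_cast at hj
    obtain ⟨R, hR, hsum⟩ := ih (by lia) (by linarith)
    have hne : (Rᶜ).Nonempty := by
      rw [← card_pos, card_compl, Fintype.card_fin]
      lia
    obtain ⟨v, hvS, hv⟩ := hno _ _ hne (isSubgraph_arcsAvoiding A R)
    have hvR : v ∉ R := by simpa using hvS
    have hout : (outDeg A v : ℝ) ≤ outDeg (arcsAvoiding A R) v + #R := by
      exact_mod_cast outDeg_le_outDeg_arcsAvoiding_add A hvR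
    have hin : (inDeg A v : ℝ) ≤ inDeg (arcsAvoiding A R) v + #R := by
      exact_mod_cast inDeg_le_inDeg_arcsAvoiding_add A hvR
    have ha := hdeg v
    rw [hR] at hout hin
    have hlt : (inDeg (arcsAvoiding A R) v : ℝ) < d :=
      (min_lt_iff.1 hv).resolve_left (by linarith)
    refine ⟨insert v R, by rw [card_insert_of_notMem hvR, hR], ?_⟩
    rw [sum_insert hvR]
    push_cast
    linarith

/-- Every oriented graph on `n` vertices with minimum outdegree at least `αn` contains a
nonempty subgraph with minimum semidegree at least `(1 - α - √(3 - 8α + 4α²))·n`. -/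
theorem dense_oriented_graph_subgraph (α : ℝ) (hα0 : 0 < α) (hα1 : α ≤ 1 / 2)
    (n : ℕ) (hn : 0 < n)
    (A : Finset (Fin n × Fin n)) (hloopless : ∀ v : Fin n, (v, v) ∉ A)
    (horiented : ∀ u v : Fin n, (u, v) ∈ A → (v, u) ∉ A)
    (hmindeg : ∀ v : Fin n, α * n ≤ (outDeg A v : ℝ)) :
    ∃ (S : Finset (Fin n)) (B : Finset (Fin n × Fin n)),
      S.Nonempty ∧ IsSubgraph A S B ∧
      ∀ v ∈ S, (1 - α - Real.sqrt (3 - 8 * α + 4 * α ^ 2)) * n ≤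
        (min (outDeg B v) (inDeg B v) : ℝ) := by
  by_contra! hno
  set r := Real.sqrt (3 - 8 * α + 4 * α ^ 2) with hr
  have hrsq : r ^ 2 = 3 - 8 * α + 4 * α ^ 2 := Real.sq_sqrt (by nlinarith)
  have hr0 : 0 ≤ r := Real.sqrt_nonneg _
  have hrα : 1 - 2 * α ≤ r := by nlinarith
  have hn0 : (0 : ℝ) < n := by exact_mod_cast hn
  have hdeg_sum (v : Fin n) : (outDeg A v + inDeg A v + 1 : ℝ) ≤ n := by
    exact_mod_cast outDeg_add_inDeg_add_one_le hloopless horiented v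
  have hn1 : (1 : ℝ) < n := by
    have h₁ := hdeg_sum ⟨0, hn⟩
    have h₂ := hmindeg ⟨0, hn⟩
    have h₃ : (0 : ℝ) ≤ inDeg A ⟨0, hn⟩ := Nat.cast_nonneg _
    have h₄ := mul_pos hα0 hn0
    linarith
  have hd : 0 < 1 - α - r := by
    obtain ⟨v, -, hv⟩ := hno Finset.univ ∅ ⟨⟨0, hn⟩, Finset.mem_univ _⟩ (by simp [IsSubgraph])
    simp only [outDeg, inDeg, Finset.filter_empty, Finset.card_empty, Nat.cast_zero,
      min_self] at hv
    exact pos_of_mul_pos_left hv hn0.le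
  -- The number of deleted vertices is the least integer exceeding `t * n`.
  set t := r - (1 - 2 * α) with ht
  have ht0 : 0 ≤ t * n := mul_nonneg (by linarith) hn0.le
  have htn : t * n < n := by nlinarith
  set T := ⌊t * n⌋₊ + 1 with hT
  have hTle : (T : ℝ) ≤ t * n + 1 := by
    have := Nat.floor_le ht0
    push_cast [hT]
    linarith
  have hTgt : t * n < T := by
    push_cast [hT]
    exact Nat.lt_floor_add_one _
  have hTn : T ≤ n := (Nat.floor_lt ht0).2 htn
  obtain ⟨R, hRcard, hRsum⟩ := exists_card_eq_sum_inDeg_le hmindeg hno T hTn (by linarith)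
  have hcompl : ∑ v ∈ Rᶜ, (inDeg A v : ℝ) ≤ (n - T) * ((1 - α) * n - 1) := by
    have h := Finset.sum_le_card_nsmul Rᶜ (fun v => (inDeg A v : ℝ)) ((1 - α) * n - 1)
      (fun v _ => by linarith [hdeg_sum v, hmindeg v])
    rwa [Finset.card_compl, hRcard, Fintype.card_fin, nsmul_eq_mul, Nat.cast_sub hTn] at h
  have htotal : α * n * n ≤ ∑ v, (inDeg A v : ℝ) := by
    have h := Finset.card_nsmul_le_sum Finset.univ (fun v => (outDeg A v : ℝ)) (α * n)
      (fun v _ => hmindeg v)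
    have hsum : ∑ v, (outDeg A v : ℝ) = ∑ v, (inDeg A v : ℝ) := by
      exact_mod_cast sum_outDeg_eq_sum_inDeg A
    rw [hsum, Finset.card_univ, Fintype.card_fin, nsmul_eq_mul] at h
    linarith
  rw [← Finset.sum_add_sum_compl R] at htotal
  have hTn' : (T : ℝ) ≤ n := by exact_mod_cast hTn
  obtain ⟨s, hs⟩ : ∃ s : ℝ, (T : ℝ) = t * n + s := ⟨T - t * n, by ring⟩
  have hs0 : 0 ≤ s := by linarith
  have hs1 : s ≤ 1 := by linarith
  have hs2 : s ^ 2 ≤ 1 := pow_le_one₀ hs0 hs1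
  have hgain : 0 ≤ s * n * (1 - 2 * α) :=
    mul_nonneg (mul_nonneg hs0 hn0.le) (by linarith)
  have hmain : r * n * T - T ^ 2 / 2 =
      (1 - 2 * α) * n ^ 2 + s * n * (1 - 2 * α) - s ^ 2 / 2 := by
    rw [hs, ht]
    linear_combination (n ^ 2 / 2 : ℝ) * hrsq
  linarith
end

section
/- For every rational number α with 0 < α ≤ 1/4 and every real ε > 0, there exist infinitely many positive integers n such that αn is an integer and there exists a tournament T on n vertices with minimum outdegree δ⁺(T) = αn such that every nonempty subgraph H of T satisfies δ±(H) ≤ (α²/2 + 6α³ + ε) · n. -/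
/-- Sets `T j ⊆ {0, …, m - 1}` of prescribed sizes `w j ≤ m` can be chosen in a balanced way:
every point lies in at most `(∑ w) / m + 1` of them. -/
theorem exists_balanced_family (m k : ℕ) (w : ℕ → ℕ) (hw : ∀ j, w j ≤ m) :
    ∃ T : ℕ → Finset ℕ, (∀ j, T j ⊆ Finset.range m) ∧ (∀ j, (T j).card = w j) ∧
      ∀ r, ((Finset.range k).filter fun j => r ∈ T j).card
        ≤ (∑ j ∈ Finset.range k, w j) / m + 1 := by
  classical
  set s : ℕ → ℕ := fun j => ∑ i ∈ Finset.range j, w i with hs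
  have hsucc : ∀ j, s (j + 1) = s j + w j := fun j => Finset.sum_range_succ w j
  have hmono : Monotone s := monotone_nat_of_le_succ fun j => by rw [hsucc]; omega
  refine ⟨fun j => (Finset.Ico (s j) (s (j + 1))).image (· % m), ?_, ?_, ?_⟩
  · intro j r hr
    obtain ⟨x, hx, rfl⟩ := Finset.mem_image.1 hr
    have := Finset.mem_Ico.1 hx
    have := hsucc j
    have := hw j
    exact Finset.mem_range.2 (Nat.mod_lt _ (by omega))
  · intro j
    rw [Finset.card_image_of_injOn, Nat.card_Ico, hsucc]
    · omega
    · refine (Nat.mod_injOn_Ico (s j) m).mono ?_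
      intro x hx
      have := Finset.mem_Ico.1 (Finset.mem_coe.1 hx)
      have := hsucc j
      have := hw j
      simp only [Finset.coe_Ico, Set.mem_Ico]
      omega
  · intro r
    have hwit : ∀ j, ∃ x, r ∈ (Finset.Ico (s j) (s (j + 1))).image (· % m) →
        s j ≤ x ∧ x < s (j + 1) ∧ x % m = r := by
      intro j
      by_cases h : r ∈ (Finset.Ico (s j) (s (j + 1))).image (· % m)
      · obtain ⟨x, hx, hr⟩ := Finset.mem_image.1 h
        have := Finset.mem_Ico.1 hx
        exact ⟨x, fun _ => ⟨this.1, this.2, hr⟩⟩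
      · exact ⟨0, fun h' => absurd h' h⟩
    choose x hx using hwit
    rw [← Finset.card_range (_ / m + 1)]
    refine Finset.card_le_card_of_injOn (fun j => x j / m) ?_ ?_
    · intro j hj
      obtain ⟨hjk, hj⟩ := Finset.mem_filter.1 (Finset.mem_coe.1 hj)
      have h := hx j hj
      have hle : s (j + 1) ≤ s k := hmono (Finset.mem_range.1 hjk)
      have : x j / m ≤ s k / m := Nat.div_le_div_right (by omega)
      exact Finset.mem_coe.2 (Finset.mem_range.2 (Nat.lt_succ_of_le this))
    · intro i hi j hj hij
      have hi := hx i (Finset.mem_filter.1 (Finset.mem_coe.1 hi)).2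
      have hj := hx j (Finset.mem_filter.1 (Finset.mem_coe.1 hj)).2
      have heq : x i = x j := by
        rw [← Nat.div_add_mod (x i) m, ← Nat.div_add_mod (x j) m, hi.2.2, hj.2.2]
        simp only at hij
        rw [hij]
      by_contra hne
      rcases lt_or_gt_of_ne hne with h | h
      · have := hmono (Nat.succ_le_of_lt h)
        simp only [Nat.succ_eq_add_one] at this
        omega
      · have := hmono (Nat.succ_le_of_lt h)
        simp only [Nat.succ_eq_add_one] at this
        omega

theorem outDeg_eq_card {n : ℕ} (A : Finset (Fin n × Fin n)) (v : Fin n) :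
    outDeg A v = (Finset.univ.filter fun w => (v, w) ∈ A).card := by
  classical
  refine (Finset.card_bij (fun w _ => (v, w)) ?_ ?_ ?_).symm
  · intro w hw
    simpa using hw
  · intro a _ b _ h
    simpa using h
  · rintro ⟨a, b⟩ h
    obtain ⟨h, rfl⟩ := Finset.mem_filter.1 h
    exact ⟨b, by simpa using h, rfl⟩

theorem inDeg_eq_card {n : ℕ} (A : Finset (Fin n × Fin n)) (v : Fin n) :
    inDeg A v = (Finset.univ.filter fun w => (w, v) ∈ A).card := by
  classical
  refine (Finset.card_bij (fun w _ => (w, v)) ?_ ?_ ?_).symm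
  · intro w hw
    simpa using hw
  · intro a _ b _ h
    simpa using h
  · rintro ⟨a, b⟩ h
    obtain ⟨h, rfl⟩ := Finset.mem_filter.1 h
    exact ⟨a, by simpa using h, rfl⟩

/-- Transitive tournament on `m + c + d` vertices in which the last `d` vertices send balanced
back arcs to the first `m` vertices, each of which receives at most `c` of them. -/
theorem exists_tournament_of_backward_arcs (n m c d : ℕ) (hn : n = m + c + d) (hd : 0 < d)
    (hdm : d ≤ m) (hc : (∑ j ∈ Finset.range d, (d - j)) / m + 1 ≤ c) :
    ∃ A : Finset (Fin n × Fin n), IsTournament A ∧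
      (∀ v : Fin n, d ≤ outDeg A v) ∧ (∃ v : Fin n, outDeg A v = d) ∧
      ∀ (S : Finset (Fin n)) (B : Finset (Fin n × Fin n)),
        S.Nonempty → IsSubgraph A S B → ∃ v ∈ S, inDeg B v ≤ c := by
  classical
  obtain ⟨T, hT, hTcard, hTdeg⟩ :=
    exists_balanced_family m d (fun j => d - j) (fun j => by omega)
  have hTm : ∀ {j r}, r ∈ T j → r < m := fun h => Finset.mem_range.1 (hT _ h)
  have hTd : ∀ {j r}, r ∈ T j → j < d := by
    intro j r h
    have := Finset.card_pos.2 ⟨r, h⟩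
    rw [hTcard] at this
    omega
  have hback : ∀ v : Fin n,
      (Finset.univ.filter fun u : Fin n => v.1 ∈ T (n - 1 - u.1)).card ≤ c := by
    intro v
    refine le_trans (Finset.card_le_card_of_injOn (fun u => n - 1 - u.1) ?_ ?_)
      ((hTdeg v.1).trans hc)
    · intro u hu
      have hu := (Finset.mem_filter.1 (Finset.mem_coe.1 hu)).2
      exact Finset.mem_coe.2 (Finset.mem_filter.2 ⟨Finset.mem_range.2 (hTd hu), hu⟩)
    · intro u _ u' _ h
      have := u.2
      have := u'.2
      simp only at h
      exact Fin.ext (by omega)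
  set A : Finset (Fin n × Fin n) := Finset.univ.filter fun e =>
    (e.1 < e.2 ∧ e.1.1 ∉ T (n - 1 - e.2.1)) ∨ e.2.1 ∈ T (n - 1 - e.1.1) with hA
  have hmem : ∀ u v : Fin n, (u, v) ∈ A ↔
      (u.1 < v.1 ∧ u.1 ∉ T (n - 1 - v.1)) ∨ v.1 ∈ T (n - 1 - u.1) := by
    intro u v
    simp only [hA, Finset.mem_filter, Finset.mem_univ, true_and, Fin.lt_def]
  have hlt : ∀ u v : Fin n, v.1 ∈ T (n - 1 - u.1) → v.1 < m ∧ m ≤ u.1 := by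
    intro u v h
    have := hTm h
    have := hTd h
    omega
  have hout : ∀ u : Fin n, m ≤ u.1 → outDeg A u = (n - 1 - u.1) + (d - (n - 1 - u.1)) := by
    intro u hu
    have hsplit : (Finset.univ.filter fun w => (u, w) ∈ A) =
        Finset.Ioi u ∪ Finset.univ.filter fun w : Fin n => w.1 ∈ T (n - 1 - u.1) := by
      ext w
      simp only [Finset.mem_filter, Finset.mem_univ, true_and, hmem, Finset.mem_union,
        Finset.mem_Ioi, Fin.lt_def]
      constructor
      · rintro (h | h)
        · exact Or.inl h.1
        · exact Or.inr h
      · rintro (h | h)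
        · exact Or.inl ⟨h, fun h' => by have := hTm h'; omega⟩
        · exact Or.inr h
    rw [outDeg_eq_card, hsplit, Finset.card_union_of_disjoint, Fin.card_Ioi, ← hTcard]
    · congr 1
      rw [← Finset.card_map Fin.valEmbedding]
      congr 1
      ext r
      simp only [Finset.mem_map, Finset.mem_filter, Finset.mem_univ, true_and,
        Fin.valEmbedding_apply]
      constructor
      · rintro ⟨w, hw, rfl⟩
        exact hw
      · intro hr
        have := hTm hr
        exact ⟨⟨r, by omega⟩, hr, rfl⟩
    · rw [Finset.disjoint_left]
      intro w hw hw'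
      have h1 := Fin.lt_def.1 (Finset.mem_Ioi.1 hw)
      have h2 := hlt u w (Finset.mem_filter.1 hw').2
      omega
  refine ⟨A, ⟨?_, ?_⟩, ?_, ?_, ?_⟩
  · intro v h
    rcases (hmem v v).1 h with h | h
    · omega
    · have := hlt v v h
      omega
  · intro u v huv
    have hne : u.1 ≠ v.1 := fun h => huv (Fin.ext h)
    have h1 := hlt u v
    have h2 := hlt v u
    rw [hmem, hmem]
    constructor
    · rintro (h | h) (h' | h')
      · omega
      · exact h.2 h'
      · exact h'.2 h
      · have := h1 h
        have := h2 h'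
        omega
    · intro h
      simp only [not_or, not_and, not_not] at h
      rcases lt_or_gt_of_ne hne with hl | hl
      · exact Or.inl ⟨hl, h.2⟩
      · exact Or.inr (h.1 hl)
  · intro u
    rcases le_or_gt m u.1 with hu | hu
    · rw [hout u hu]
      omega
    · have hsub : (Finset.univ.filter fun w : Fin n => m ≤ w.1) \
          (Finset.univ.filter fun w : Fin n => u.1 ∈ T (n - 1 - w.1)) ⊆
          Finset.univ.filter fun w => (u, w) ∈ A := by
        intro w hw
        simp only [Finset.mem_sdiff, Finset.mem_filter, Finset.mem_univ, true_and] at hw ⊢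
        exact (hmem u w).2 (Or.inl ⟨by omega, hw.2⟩)
      have hcard : (Finset.univ.filter fun w : Fin n => m ≤ w.1).card = n - m := by
        have : (Finset.univ.filter fun w : Fin n => m ≤ w.1) =
            Finset.Ici (⟨m, by omega⟩ : Fin n) := by
          ext w
          simp [Fin.le_def]
        rw [this, Fin.card_Ici]
      have h1 := Finset.card_le_card hsub
      have h2 := Finset.le_card_sdiff
        (Finset.univ.filter fun w : Fin n => u.1 ∈ T (n - 1 - w.1))
        (Finset.univ.filter fun w : Fin n => m ≤ w.1)
      have h3 := hback u
      rw [outDeg_eq_card]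
      omega
  · refine ⟨⟨n - 1, by omega⟩, ?_⟩
    rw [hout _ (by simp only; omega)]
    simp
  · intro S B hS hB
    refine ⟨S.min' hS, S.min'_mem hS, le_trans ?_ (hback (S.min' hS))⟩
    rw [inDeg_eq_card]
    refine Finset.card_le_card fun w hw => ?_
    have hw := (Finset.mem_filter.1 hw).2
    refine Finset.mem_filter.2 ⟨Finset.mem_univ _, ?_⟩
    rcases (hmem _ _).1 (hB.1 hw) with h | h
    · exact absurd (S.min'_le w (hB.2 _ hw).1) (not_le.2 (Fin.lt_def.2 h.1))
    · exact h

theorem two_mul_sum_range_tsub (d : ℕ) :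
    2 * ∑ j ∈ Finset.range d, (d - j) = d * (d + 1) := by
  have h : ∑ j ∈ Finset.range d, (d - j) = ∑ j ∈ Finset.range d, (j + 1) := by
    rw [← Finset.sum_range_reflect]
    refine Finset.sum_congr rfl fun j hj => ?_
    have := Finset.mem_range.1 hj
    omega
  have h' := Finset.sum_range_id_mul_two (d + 1)
  rw [Finset.sum_range_succ'] at h'
  rw [h]
  simp only [add_zero, Nat.add_sub_cancel] at h'
  linarith

theorem sum_div_add_one_le {a : ℝ} (ha0 : 0 < a) (ha1 : a ≤ 1 / 4) {n d c m : ℕ}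
    (hd : (d : ℝ) = a * n) (hn : 3 ≤ a ^ 3 * n)
    (hc : c = ⌊(a ^ 2 / 2 + 6 * a ^ 3) * n⌋₊) (hm : n = m + c + d) :
    (∑ j ∈ Finset.range d, (d - j)) / m + 1 ≤ c := by
  set C : ℝ := a ^ 2 / 2 + 6 * a ^ 3 with hC
  have hn0 : (0 : ℝ) < n := by
    by_contra h
    have : (n : ℝ) = 0 := le_antisymm (not_lt.1 h) (Nat.cast_nonneg n)
    rw [this] at hn
    linarith
  have hC0 : 0 < C := by positivity
  have ha3 : a ^ 3 ≤ a ^ 2 / 4 := by nlinarith [sq_nonneg a]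
  have hC1 : C ≤ a / 2 := by nlinarith
  have hcu : (c : ℝ) ≤ C * n := by rw [hc]; exact Nat.floor_le (by positivity)
  have hcl : C * n - 1 < c := by rw [hc]; exact Nat.sub_one_lt_floor _
  have hmn : (n : ℝ) = m + c + d := by exact_mod_cast hm
  have hml : (1 - a - C) * n ≤ m := by rw [hd] at hmn; linarith
  have hm0 : (0 : ℝ) < m := lt_of_lt_of_le (mul_pos (by linarith) hn0) hml
  have hsum : 2 * ((∑ j ∈ Finset.range d, (d - j) : ℕ) : ℝ) = d * (d + 1) := by
    exact_mod_cast two_mul_sum_range_tsub d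
  have hkey : a ^ 2 / 2 + 3 * a ^ 3 ≤ C * (1 - a - C) := by
    have h1 : C * (1 - 3 / 2 * a) ≤ C * (1 - a - C) :=
      mul_le_mul_of_nonneg_left (by linarith) hC0.le
    have h2 : a ^ 4 ≤ a ^ 3 / 4 := by nlinarith [pow_pos ha0 3]
    have h3 : a ^ 2 / 2 + 3 * a ^ 3 ≤ C * (1 - 3 / 2 * a) := by
      rw [hC]; ring_nf; linarith [pow_pos ha0 3]
    linarith
  have hlin : a * (a * n + 1) / 2 ≤ (C * n - 2) * (1 - a - C) := by
    have := mul_le_mul_of_nonneg_right hkey hn0.le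
    nlinarith
  have hCn : 0 ≤ C * n - 2 := by
    rw [hC]
    have : 0 ≤ a ^ 2 / 2 * n := by positivity
    linarith
  have hfin : ((∑ j ∈ Finset.range d, (d - j) : ℕ) : ℝ) < ((c : ℝ) - 1) * m := by
    have h1 : ((∑ j ∈ Finset.range d, (d - j) : ℕ) : ℝ) = a * (a * n + 1) / 2 * n := by
      rw [hd] at hsum; linarith
    have h2 := mul_le_mul_of_nonneg_right hlin hn0.le
    have h3 := mul_le_mul_of_nonneg_left hml hCn
    have h4 : (C * n - 2) * m < ((c : ℝ) - 1) * m :=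
      mul_lt_mul_of_pos_right (by linarith) hm0
    rw [h1]
    linarith
  have hc1 : 1 ≤ c := by
    have : (0 : ℝ) < c := by linarith
    exact_mod_cast this
  have : (∑ j ∈ Finset.range d, (d - j)) < (c - 1) * m := by
    rw [← Nat.cast_lt (α := ℝ)]
    push_cast [hc1] at hfin ⊢
    exact hfin
  have := Nat.div_lt_of_lt_mul (this.trans_eq (mul_comm _ _))
  omega

/-- For every rational `0 < α ≤ 1/4` and every `ε > 0` there are infinitely many `n`
such that `αn ∈ ℕ` and some `n`-vertex tournament with minimum outdegree exactly `αn`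
has all nonempty subgraphs of minimum semidegree at most `(α²/2 + 6α³ + ε)·n`. -/
theorem dense_tournament_construction (α : ℚ) (hα0 : 0 < α) (hα1 : α ≤ 1 / 4)
    (ε : ℝ) (hε : 0 < ε) (N : ℕ) :
    ∃ n : ℕ, N ≤ n ∧ 0 < n ∧ ∃ d : ℕ, (d : ℚ) = α * n ∧
      ∃ A : Finset (Fin n × Fin n), IsTournament A ∧
        (∀ v : Fin n, d ≤ outDeg A v) ∧ (∃ v : Fin n, outDeg A v = d) ∧
        ∀ (S : Finset (Fin n)) (B : Finset (Fin n × Fin n)),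
          S.Nonempty → IsSubgraph A S B →
          ∃ v ∈ S, (min (outDeg B v) (inDeg B v) : ℝ) ≤
            ((α : ℝ) ^ 2 / 2 + 6 * (α : ℝ) ^ 3 + ε) * n := by
  have ha0 : (0 : ℝ) < α := by exact_mod_cast hα0
  have ha1 : (α : ℝ) ≤ 1 / 4 := by
    have : ((α : ℚ) : ℝ) ≤ ((1 / 4 : ℚ) : ℝ) := by exact_mod_cast hα1
    simpa using this
  set a : ℝ := (α : ℝ) with ha
  obtain ⟨K, hK⟩ := exists_nat_ge (3 / a ^ 3)
  set k : ℕ := N + K + 1 with hk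
  set n : ℕ := α.den * k with hn
  set d : ℕ := α.num.toNat * k with hd
  have hkn : k ≤ n := Nat.le_mul_of_pos_left k α.den_pos
  have hdQ : (d : ℚ) = α * n := by
    have hnum : ((α.num.toNat : ℕ) : ℚ) = α.num := by
      exact_mod_cast Int.toNat_of_nonneg (Rat.num_nonneg.2 hα0.le)
    rw [hd, hn]
    push_cast
    rw [hnum, ← mul_assoc, Rat.mul_den_eq_num]
  have hdR : (d : ℝ) = a * n := by
    rw [ha]
    exact_mod_cast hdQ
  have hn0 : (0 : ℝ) < n := by
    have : 0 < n := by omega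
    exact_mod_cast this
  have hn3 : 3 ≤ a ^ 3 * n := by
    have h1 : (K : ℝ) ≤ n := by
      have : K ≤ n := by omega
      exact_mod_cast this
    rw [div_le_iff₀ (by positivity)] at hK
    nlinarith [pow_pos ha0 3]
  set c : ℕ := ⌊(a ^ 2 / 2 + 6 * a ^ 3) * n⌋₊ with hc
  have hcu : (c : ℝ) ≤ (a ^ 2 / 2 + 6 * a ^ 3) * n := Nat.floor_le (by positivity)
  have hcd : c + 2 * d ≤ n := by
    have h3 : a ^ 3 ≤ a ^ 2 / 4 := by nlinarith [sq_nonneg a]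
    have h2 : a ^ 2 / 2 + 6 * a ^ 3 ≤ a / 2 := by nlinarith
    have h4 : (a ^ 2 / 2 + 6 * a ^ 3) * n ≤ 1 / 8 * n :=
      mul_le_mul_of_nonneg_right (by linarith) hn0.le
    have h5 : a * n ≤ 1 / 4 * n := mul_le_mul_of_nonneg_right ha1 hn0.le
    have : (c : ℝ) + 2 * d ≤ n := by
      rw [hdR]
      linarith
    exact_mod_cast this
  have hd0 : 0 < d := by
    have : (0 : ℝ) < d := by rw [hdR]; positivity
    exact_mod_cast this
  obtain ⟨A, hA, hmin, hex, hsub⟩ := exists_tournament_of_backward_arcs n (n - c - d) c d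
    (by omega) hd0 (by omega) (sum_div_add_one_le ha0 ha1 hdR hn3 hc (by omega))
  refine ⟨n, by omega, by omega, d, hdQ, A, hA, hmin, hex, fun S B hS hB => ?_⟩
  obtain ⟨v, hv, hvc⟩ := hsub S B hS hB
  refine ⟨v, hv, (min_le_right _ _).trans ?_⟩
  have h1 : (inDeg B v : ℝ) ≤ c := by exact_mod_cast hvc
  have h2 : 0 ≤ ε * n := by positivity
  linarith
end

section
/- For every real ε > 0 and every positive integer ℓ there exists a positive integer k₀ such that for every integer k ≥ k₀, setting d := 2kℓ − 1 and n := (k+1)d + ℓ, there exists a tournament T on n vertices with minimum outdegree δ⁺(T) = d such that every nonempty subgraph H of T satisfies δ±(H) ≤ ℓ, and moreover ℓ ≤ (1 + ε) · d(d+1)/(2n). In particular, for d tending to infinity with d = o(n), the bound of the main theorem (every n-vertex digraph with δ⁺ ≥ d has a subgraph H with δ±(H) ≥ d(d+1)/(2n)) is asymptotically best possible. -/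
open Finset in
theorem outDeg_filter_univ {n : ℕ} (P : Fin n → Fin n → Prop) [DecidableRel P] (v : Fin n) :
    outDeg (univ.filter fun e : Fin n × Fin n => P e.1 e.2) v = #{w | P v w} := by
  unfold outDeg
  refine card_nbij' (fun e => e.2) (fun w => (v, w)) ?_ ?_ ?_ ?_
  · rintro ⟨a, b⟩ h
    simp at h ⊢
    rw [← h.2]; exact h.1
  · intro w h
    simpa using h
  · rintro ⟨a, b⟩ h
    simp at h
    simp [h.2]
  · intro w _
    rfl

/-- The `q`-th triangular number `0 + 1 + ⋯ + q`. -/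
def triangular (q : ℕ) : ℕ := ∑ i ∈ Finset.range (q + 1), i

theorem triangular_succ (q : ℕ) : triangular (q + 1) = triangular q + (q + 1) :=
  Finset.sum_range_succ _ _

theorem triangular_mono : Monotone triangular :=
  monotone_nat_of_le_succ fun q => by rw [triangular_succ]; omega

theorem triangular_mul_two (q : ℕ) : triangular q * 2 = q * (q + 1) := by
  rw [triangular, Finset.sum_range_id_mul_two, Nat.add_sub_cancel, mul_comm]

theorem triangular_add_lt {q r t : ℕ} (ht : t ≤ q) (h : q < r) :
    triangular q + t < triangular r := by
  have := triangular_mono (Nat.succ_le_of_lt h)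
  rw [Nat.succ_eq_add_one, triangular_succ] at this
  omega

theorem eq_of_triangular_add_eq {q r s t : ℕ} (hs : s ≤ q) (ht : t ≤ r)
    (h : triangular q + s = triangular r + t) : q = r := by
  rcases lt_trichotomy q r with hlt | heq | hlt
  · have := triangular_add_lt hs hlt
    omega
  · exact heq
  · have := triangular_add_lt ht hlt
    omega

/-- The backward arcs of the extremal tournament: the vertex `b + q` sends arcs to the `q + 1`
vertices that come next in the cyclic order on `{0, …, m - 1}`, starting where the
vertex `b + q - 1` stopped. -/
def BackArc (m b u v : ℕ) : Prop :=
  b ≤ u ∧ ∃ t ≤ u - b, v = (triangular (u - b) + t) % m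

theorem BackArc.lt {m b u v : ℕ} (hm : 0 < m) (h : BackArc m b u v) : v < m := by
  obtain ⟨-, t, -, rfl⟩ := h
  exact Nat.mod_lt _ hm

open Finset Classical in
theorem card_backArc_out {n m b : ℕ} (hmn : m ≤ n) (u : ℕ) (hbu : b ≤ u) (hum : u - b < m) :
    #{w : Fin n | BackArc m b u w} = u - b + 1 := by
  have hm : 0 < m := by omega
  have hlt (t : ℕ) : (triangular (u - b) + t) % m < n := (Nat.mod_lt _ hm).trans_le hmn
  have himage : (univ.filter fun w : Fin n => BackArc m b u w) =
      (range (u - b + 1)).image fun t => ⟨(triangular (u - b) + t) % m, hlt t⟩ := by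
    ext w
    simp only [mem_filter, mem_univ, true_and, mem_image, mem_range, BackArc, hbu, Fin.ext_iff,
      Nat.lt_succ_iff, eq_comm]
  rw [himage, card_image_of_injOn, card_range]
  intro s hs t ht hst
  simp only [coe_range, Set.mem_Iio, Fin.mk.injEq] at hs ht hst
  exact (Nat.ModEq.add_left_cancel' (triangular (u - b)) hst).eq_of_lt_of_lt
    (by omega) (by omega)

open Finset Classical in
theorem card_backArc_in_le {n m b d l : ℕ} (hn : n ≤ b + d) (hd : triangular d ≤ m * l)
    (v : ℕ) : #{u : Fin n | BackArc m b u v} ≤ l := by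
  rw [← card_range l]
  refine card_le_card_of_forall_subsingleton
    (fun (u : Fin n) (c : ℕ) => b ≤ u ∧ ∃ t ≤ u - b, triangular (u - b) + t = m * c + v) ?_ ?_
  · intro u hu
    obtain ⟨hbu, t, ht, rfl⟩ := (mem_filter.1 hu).2
    refine ⟨(triangular (u - b) + t) / m, ?_, hbu, t, ht, (Nat.div_add_mod _ _).symm⟩
    rw [mem_range]
    have := triangular_add_lt (r := d) ht (by omega)
    exact Nat.div_lt_of_lt_mul (this.trans_le hd)
  · rintro c - u ⟨-, hu, s, hs, hsc⟩ w ⟨-, hw, t, ht, htc⟩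
    have := eq_of_triangular_add_eq hs ht (hsc.trans htc.symm)
    exact Fin.ext (by omega)

/-- Adjacency in the extremal tournament: the transitive tournament with the arcs of `BackArc`
reversed. -/
def ExtremalArc (m b u v : ℕ) : Prop :=
  u < v ∧ ¬ BackArc m b v u ∨ BackArc m b u v

open Finset Classical in
/-- The extremal tournament on `Fin n`. -/
noncomputable def extremalTournament (n m b : ℕ) : Finset (Fin n × Fin n) :=
  univ.filter fun e => ExtremalArc m b e.1 e.2

theorem mem_extremalTournament {n m b : ℕ} {u v : Fin n} :
    (u, v) ∈ extremalTournament n m b ↔ ExtremalArc m b u v := by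
  simp [extremalTournament]

theorem BackArc.lt_of_le {m b u v : ℕ} (hm : 0 < m) (hmb : m ≤ b) (h : BackArc m b u v) :
    v < u :=
  (h.lt hm).trans_le (hmb.trans h.1)

theorem isTournament_extremalTournament {n m b : ℕ} (hm : 0 < m) (hmb : m ≤ b) :
    IsTournament (extremalTournament n m b) := by
  constructor
  · intro v hv
    rcases mem_extremalTournament.1 hv with h | h
    · exact h.1.false
    · exact (h.lt_of_le hm hmb).false
  · intro u v huv
    have hne : (u : ℕ) ≠ v := Fin.val_ne_of_ne huv
    have h₁ := BackArc.lt_of_le (u := u) (v := v) hm hmb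
    have h₂ := BackArc.lt_of_le (u := v) (v := u) hm hmb
    simp only [mem_extremalTournament, ExtremalArc]
    grind

open Finset Classical in
theorem outDeg_extremalTournament_of_le {n m b d : ℕ} (hn : n = b + d) (hdm : d ≤ m)
    (hmb : m ≤ b) (v : Fin n) (hv : b ≤ v) : outDeg (extremalTournament n m b) v = d := by
  have hvn := v.isLt
  have hm : 0 < m := by omega
  have hsplit : (univ.filter fun w : Fin n => ExtremalArc m b v w) =
      Ioi v ∪ univ.filter fun w : Fin n => BackArc m b v w := by
    ext w
    have hw : BackArc m b w v → (v : ℕ) < m := BackArc.lt hm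
    simp only [ExtremalArc, mem_filter, mem_univ, true_and, mem_union, mem_Ioi, Fin.lt_def]
    grind
  have hdisj : Disjoint (Ioi v) (univ.filter fun w : Fin n => BackArc m b v w) := by
    rw [disjoint_left]
    intro w hw hback
    have := ((mem_filter.1 hback).2).lt_of_le hm hmb
    have := Fin.lt_def.1 (mem_Ioi.1 hw)
    omega
  rw [extremalTournament, outDeg_filter_univ (fun u w : Fin n => ExtremalArc m b u w), hsplit,
    card_union_of_disjoint hdisj, Fin.card_Ioi, card_backArc_out (by omega) v hv (by omega)]
  omega

open Finset Classical in
theorem le_outDeg_extremalTournament {n m d l : ℕ} (hn : n = m + l + d) (hm : 0 < m)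
    (hdm : d ≤ m) (hd : triangular d ≤ m * l) (v : Fin n) :
    d ≤ outDeg (extremalTournament n m (m + l)) v := by
  by_cases hv : m + l ≤ v
  · exact (outDeg_extremalTournament_of_le hn hdm (by omega) v hv).ge
  have hsub : Ioi v \ (univ.filter fun w : Fin n => BackArc m (m + l) w v) ⊆
      univ.filter fun w : Fin n => ExtremalArc m (m + l) v w := by
    intro w hw
    simp only [mem_sdiff, mem_Ioi, mem_filter, mem_univ, true_and, Fin.lt_def] at hw
    exact mem_filter.2 ⟨mem_univ _, Or.inl hw⟩
  rw [extremalTournament, outDeg_filter_univ (fun u w : Fin n => ExtremalArc m (m + l) u w)]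
  refine le_trans ?_ (card_le_card hsub)
  refine le_trans ?_ (le_card_sdiff _ _)
  rw [Fin.card_Ioi]
  by_cases hvm : (v : ℕ) < m
  · have := card_backArc_in_le (n := n) (b := m + l) hn.le hd v
    omega
  · have hempty : (univ.filter fun w : Fin n => BackArc m (m + l) w v) = ∅ :=
      filter_eq_empty_iff.2 fun w _ hw => hvm (hw.lt hm)
    rw [hempty, card_empty]
    omega

open Finset Classical in
theorem exists_inDeg_le_of_isSubgraph_extremalTournament {n m b d l : ℕ} (hn : n ≤ b + d)
    (hd : triangular d ≤ m * l) {S : Finset (Fin n)} {B : Finset (Fin n × Fin n)}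
    (hS : S.Nonempty) (hB : IsSubgraph (extremalTournament n m b) S B) :
    ∃ v ∈ S, inDeg B v ≤ l := by
  refine ⟨S.min' hS, S.min'_mem hS, le_trans ?_ (card_backArc_in_le hn hd (S.min' hS))⟩
  refine card_le_card_of_injOn Prod.fst ?_ ?_
  · rintro ⟨u, w⟩ h
    obtain ⟨hmem, rfl⟩ := mem_filter.1 h
    have hle := Fin.le_def.1 (S.min'_le u (hB.2 _ hmem).1)
    rcases mem_extremalTournament.1 (hB.1 hmem) with hlt | hback
    · exact absurd hlt.1 hle.not_gt
    · exact mem_filter.2 ⟨mem_univ _, hback⟩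
  · rintro ⟨u, w⟩ h ⟨u', w'⟩ h' heq
    exact Prod.ext heq ((mem_filter.1 h).2.trans (mem_filter.1 h').2.symm)

/-- For every `ε > 0` and positive `ℓ`, for all large enough `k`, with `d = 2kℓ - 1` and
`n = (k+1)d + ℓ`, there is an `n`-vertex tournament with minimum outdegree exactly `d`
whose nonempty subgraphs all have minimum semidegree at most `ℓ`, and moreover
`ℓ ≤ (1 + ε)·d(d+1)/(2n)`; hence the main theorem is asymptotically best possible. -/
theorem main_theorem_asymptotically_optimal (ε : ℝ) (hε : 0 < ε) (ℓ : ℕ) (hℓ : 0 < ℓ) :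
    ∃ k₀ : ℕ, 0 < k₀ ∧ ∀ k : ℕ, k₀ ≤ k →
      ∃ A : Finset (Fin ((k + 1) * (2 * k * ℓ - 1) + ℓ) ×
          Fin ((k + 1) * (2 * k * ℓ - 1) + ℓ)),
        IsTournament A ∧
        (∀ v, 2 * k * ℓ - 1 ≤ outDeg A v) ∧
        (∃ v, outDeg A v = 2 * k * ℓ - 1) ∧
        (∀ (S : Finset (Fin ((k + 1) * (2 * k * ℓ - 1) + ℓ)))
            (B : Finset (Fin ((k + 1) * (2 * k * ℓ - 1) + ℓ) ×
              Fin ((k + 1) * (2 * k * ℓ - 1) + ℓ))),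
          S.Nonempty → IsSubgraph A S B →
          ∃ v ∈ S, min (outDeg B v) (inDeg B v) ≤ ℓ) ∧
        (ℓ : ℝ) ≤ (1 + ε) * (((2 * k * ℓ - 1 : ℕ) : ℝ) * (((2 * k * ℓ - 1 : ℕ) : ℝ) + 1) /
          (2 * (((k + 1) * (2 * k * ℓ - 1) + ℓ : ℕ) : ℝ))) := by
  obtain ⟨K, hK⟩ := exists_nat_ge (2 / ε)
  refine ⟨K + 1, K.succ_pos, fun k hk => ?_⟩
  obtain ⟨d, hd⟩ : ∃ d, d = 2 * k * ℓ - 1 := ⟨_, rfl⟩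
  rw [← hd]
  have hkl : ℓ ≤ k * ℓ := Nat.le_mul_of_pos_left ℓ (by omega)
  have hd1 : d + 1 = 2 * k * ℓ := by
    rw [mul_assoc] at hd ⊢
    omega
  have hld : ℓ ≤ d := by
    rw [mul_assoc] at hd1
    omega
  have hn : (k + 1) * d + ℓ = k * d + ℓ + d := by ring
  have hdm : d ≤ k * d := Nat.le_mul_of_pos_left d (by omega)
  have htri : triangular d ≤ k * d * ℓ := by
    have h := triangular_mul_two d
    rw [hd1] at h
    linarith
  refine ⟨extremalTournament _ (k * d) (k * d + ℓ),
    isTournament_extremalTournament (by omega) (by omega),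
    le_outDeg_extremalTournament hn (by omega) hdm htri,
    ⟨⟨k * d + ℓ, by omega⟩, outDeg_extremalTournament_of_le hn hdm (by omega) _ le_rfl⟩,
    fun S B hS hB => ?_, ?_⟩
  · obtain ⟨v, hv, hle⟩ := exists_inDeg_le_of_isSubgraph_extremalTournament hn.le htri hS hB
    exact ⟨v, hv, (min_le_right _ _).trans hle⟩
  · have hεk : 2 ≤ ε * k := by
      have hKk : (K : ℝ) ≤ k := by exact_mod_cast (Nat.le_succ K).trans hk
      rw [mul_comm]
      exact (div_le_iff₀ hε).1 (hK.trans hKk)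
    have hd1' : (d : ℝ) + 1 = 2 * k * ℓ := by exact_mod_cast hd1
    have hld' : (ℓ : ℝ) ≤ d := by exact_mod_cast hld
    have hℓ' : (0 : ℝ) < ℓ := by exact_mod_cast hℓ
    have hbound : ((k : ℝ) + 1) * d + ℓ ≤ (1 + ε) * (k * d) := by
      have := mul_le_mul_of_nonneg_right hεk d.cast_nonneg
      linarith
    push_cast
    rw [hd1', ← mul_div_assoc, le_div_iff₀ (by positivity)]
    have := mul_le_mul_of_nonneg_left hbound hℓ'.le
    linarith
end

section
/- Let d and ℓ be positive integers and let B be a finite set with |B| ≥ d and ℓ · |B| = d(d+1)/2. Then there exist subsets S_1, S_2, …, S_d of B such that |S_i| = i for every i ∈ {1, …, d} and every element of B belongs to exactly ℓ of the sets S_1, …, S_d. -/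
theorem Nat.mod_injOn_Ico_add (s k n : ℕ) (hk : k ≤ n) :
    Set.InjOn (· % n) (Finset.Ico s (s + k) : Set ℕ) := by
  intro x hx y hy hxy
  simp only [Finset.coe_Ico, Set.mem_Ico] at hx hy
  have h : x ≡ y [MOD n] := hxy
  rcases le_total x y with hle | hle
  · have := Nat.eq_zero_of_dvd_of_lt ((Nat.modEq_iff_dvd' hle).1 h) (by omega)
    omega
  · have := Nat.eq_zero_of_dvd_of_lt ((Nat.modEq_iff_dvd' hle).1 h.symm) (by omega)
    omega

/-- The `i`-th of the consecutive cyclic intervals modulo `n` with lengths `a 0, a 1, …`. -/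
def cyclicBlock (a : ℕ → ℕ) (n i : ℕ) : Finset ℕ :=
  (Finset.Ico (∑ j ∈ Finset.range i, a j) (∑ j ∈ Finset.range i, a j + a i)).image (· % n)

theorem card_cyclicBlock (a : ℕ → ℕ) (n i : ℕ) (h : a i ≤ n) :
    (cyclicBlock a n i).card = a i := by
  rw [cyclicBlock, Finset.card_image_of_injOn (Nat.mod_injOn_Ico_add _ _ _ h), Nat.card_Ico,
    Nat.add_sub_cancel_left]

theorem sum_mem_cyclicBlock (a : ℕ → ℕ) (n v k : ℕ) (h : ∀ i < k, a i ≤ n) :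
    (∑ i ∈ Finset.range k, if v ∈ cyclicBlock a n i then 1 else 0) =
      ((Finset.range (∑ j ∈ Finset.range k, a j)).filter (· % n = v)).card := by
  induction k with
  | zero => simp
  | succ k ih =>
    rw [Finset.sum_range_succ, ih fun i hi => h i (by omega), Finset.sum_range_succ]
    set s := ∑ j ∈ Finset.range k, a j with hs
    have hsplit : Finset.range (s + a k) = Finset.range s ∪ Finset.Ico s (s + a k) := by
      ext x
      simp only [Finset.mem_range, Finset.mem_union, Finset.mem_Ico]
      omega
    have hdisj : Disjoint (Finset.range s) (Finset.Ico s (s + a k)) := by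
      rw [Finset.disjoint_left]
      intro x hx hx'
      simp only [Finset.mem_range, Finset.mem_Ico] at hx hx'
      omega
    rw [hsplit, Finset.filter_union,
      Finset.card_union_of_disjoint (Finset.disjoint_filter_filter hdisj)]
    congr 1
    have hle : ((Finset.Ico s (s + a k)).filter (· % n = v)).card ≤ 1 := by
      refine Finset.card_le_one.2 fun x hx y hy => ?_
      rw [Finset.mem_filter] at hx hy
      exact Nat.mod_injOn_Ico_add s (a k) n (h k (by omega)) hx.1 hy.1 (hx.2.trans hy.2.symm)
    split_ifs with hv
    · obtain ⟨x, hx, hxv⟩ := Finset.mem_image.1 hv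
      exact le_antisymm (Finset.card_pos.2 ⟨x, Finset.mem_filter.2 ⟨hx, hxv⟩⟩) hle
    · refine (Finset.card_eq_zero.2 (Finset.filter_eq_empty_iff.2 fun x hx hxv => ?_)).symm
      exact hv (Finset.mem_image.2 ⟨x, hx, hxv⟩)

theorem Nat.card_filter_range_mul_mod_eq (l n v : ℕ) (hv : v < n) :
    ((Finset.range (l * n)).filter (· % n = v)).card = l := by
  have hn : 0 < n := by omega
  have h := Nat.count_modEq_card (l * n) hn v
  rw [Nat.count_eq_card_filter_range, Nat.mul_div_cancel _ hn, Nat.mul_mod_left] at h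
  simpa [Nat.ModEq, Nat.mod_eq_of_lt hv] using h

/-- Arc-distribution lemma: if `|B| ≥ d` and `ℓ·|B| = d(d+1)/2`, then there are sets
`S_1 ⊆ B, …, S_d ⊆ B` with `|S_i| = i` such that every element of `B` lies in exactly
`ℓ` of them. (Here `S i` for `i : Fin d` plays the role of `S_{i+1}`.) -/
theorem arc_distribution {β : Type*} [DecidableEq β] (d ℓ : ℕ) (hd : 0 < d) (hℓ : 0 < ℓ)
    (B : Finset β) (hB : d ≤ B.card) (hcount : 2 * (ℓ * B.card) = d * (d + 1)) :
    ∃ S : Fin d → Finset β,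
      (∀ i : Fin d, S i ⊆ B ∧ (S i).card = (i : ℕ) + 1) ∧
      ∀ b ∈ B, (Finset.univ.filter fun i : Fin d => b ∈ S i).card = ℓ := by
  have hn : 0 < B.card := hd.trans_le hB
  obtain ⟨g, hg⟩ : ∃ g : β → ℕ, Set.BijOn g B (Finset.range B.card) :=
    B.finite_toSet.exists_bijOn_of_encard_eq (by
      simp only [Set.encard_coe_eq_coe_finsetCard, Finset.card_range])
  have hsum : ∑ j ∈ Finset.range d, (j + 1) = ℓ * B.card := by
    have h₁ := Finset.sum_range_id_mul_two (d + 1)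
    rw [Finset.sum_range_succ'] at h₁
    simp only [Nat.add_sub_cancel, add_zero] at h₁
    linarith
  refine ⟨fun i => B.filter fun b => g b ∈ cyclicBlock (· + 1) B.card i, fun i =>
    ⟨Finset.filter_subset _ _, ?_⟩, fun b hb => ?_⟩
  · rw [← card_cyclicBlock (· + 1) B.card i (by have := i.2; omega)]
    refine Finset.card_bij (fun b _ => g b) (fun b hb => (Finset.mem_filter.1 hb).2)
      (fun b hb c hc h => hg.injOn (Finset.mem_filter.1 hb).1 (Finset.mem_filter.1 hc).1 h)
      fun y hy => ?_
    obtain ⟨x, -, hxy⟩ := Finset.mem_image.1 hy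
    obtain ⟨b, hb, rfl⟩ := hg.surjOn (Finset.mem_coe.2 (Finset.mem_range.2
      (hxy ▸ Nat.mod_lt x hn)))
    exact ⟨b, Finset.mem_filter.2 ⟨hb, hy⟩, rfl⟩
  · simp only [Finset.mem_filter, hb, true_and]
    rw [Finset.card_filter, Fin.sum_univ_eq_sum_range
      (fun i => if g b ∈ cyclicBlock (· + 1) B.card i then 1 else 0) d,
      sum_mem_cyclicBlock _ _ _ _ fun i hi => by omega, hsum]
    exact Nat.card_filter_range_mul_mod_eq ℓ B.card (g b) (Finset.mem_range.1 (hg.mapsTo hb))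
end
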